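/- arXiv:1201.5071 — 7 statements merged into one kernel-verified Lean document; each statement's English description precedes it below -/
import Mathlib

section
/- Every finite-dimensional complex left Leibniz algebra M admits a Levi decomposition: there exists a subspace S ⊆ M that is closed under the bracket, satisfies [s,s] = 0 for all s ∈ S, is a semisimple Lie algebra under the restricted bracket, and satisfies M = B(M) ⊕ S as vector spaces, where B(M) is the solvable radical of M. -/
open Submodule

section LeibnizDefs

variable {M : Type*} [AddCommGroup M] [Module ℂ M]

/-- The left Leibniz identity for a bilinear bracket. -/
def IsLeftLeibniz (br : M →ₗ[ℂ] M →ₗ[ℂ] M) : Prop :=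
  ∀ a b c : M, br a (br b c) = br (br a b) c + br b (br a c)

/-- The right Leibniz identity for a bilinear bracket. -/
def IsRightLeibniz (br : M →ₗ[ℂ] M →ₗ[ℂ] M) : Prop :=
  ∀ a b c : M, br (br a b) c = br (br a c) b + br a (br b c)

/-- Left central: `[a,[b,b]] = 0` for all `a, b`. -/
def IsLeftCentral (br : M →ₗ[ℂ] M →ₗ[ℂ] M) : Prop :=
  ∀ a b : M, br a (br b b) = 0

/-- The Leibniz kernel `C(M)`, the span of all squares `[a,a]`. -/
def leibnizKernel (br : M →ₗ[ℂ] M →ₗ[ℂ] M) : Submodule ℂ M :=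
  Submodule.span ℂ {x | ∃ a : M, br a a = x}

/-- A two-sided ideal of a Leibniz algebra. -/
def IsTwoSidedIdeal (br : M →ₗ[ℂ] M →ₗ[ℂ] M) (U : Submodule ℂ M) : Prop :=
  ∀ m u : M, u ∈ U → br m u ∈ U ∧ br u m ∈ U

/-- A Lie subalgebra: a subspace closed under the bracket on which the bracket is alternating. -/
def IsLieSubalgebra (br : M →ₗ[ℂ] M →ₗ[ℂ] M) (L : Submodule ℂ M) : Prop :=
  (∀ a ∈ L, ∀ b ∈ L, br a b ∈ L) ∧ ∀ a ∈ L, br a a = 0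

/-- The derived series of a subspace. -/
def leibDerivedSeries (br : M →ₗ[ℂ] M →ₗ[ℂ] M) (U : Submodule ℂ M) : ℕ → Submodule ℂ M
  | 0 => U
  | n + 1 => Submodule.span ℂ
      {x | ∃ a ∈ leibDerivedSeries br U n, ∃ b ∈ leibDerivedSeries br U n, br a b = x}

/-- Solvability of a subspace. -/
def IsLeibnizSolvable (br : M →ₗ[ℂ] M →ₗ[ℂ] M) (U : Submodule ℂ M) : Prop :=
  ∃ n : ℕ, leibDerivedSeries br U n = ⊥

/-- `B` is the solvable radical: the largest solvable two-sided ideal. -/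
def IsSolvableRadical (br : M →ₗ[ℂ] M →ₗ[ℂ] M) (B : Submodule ℂ M) : Prop :=
  IsTwoSidedIdeal br B ∧ IsLeibnizSolvable br B ∧
    ∀ U : Submodule ℂ M, IsTwoSidedIdeal br U → IsLeibnizSolvable br U → U ≤ B

/-- Semisimplicity of a bracket-closed subspace `S` on which the bracket is a Lie bracket,
expressed via the standard characterization (valid for finite-dimensional complex Lie
algebras): `S` has no nonzero abelian ideal. -/
def IsSemisimpleSubalgebra (br : M →ₗ[ℂ] M →ₗ[ℂ] M) (S : Submodule ℂ M) : Prop :=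
  ∀ A : Submodule ℂ M, A ≤ S →
    (∀ s ∈ S, ∀ a ∈ A, br s a ∈ A ∧ br a s ∈ A) →
    (∀ a ∈ A, ∀ b ∈ A, br a b = 0) → A = ⊥

/-- The truncated exponential series of an endomorphism; if `f ^ n = 0` this is `exp f`. -/
noncomputable def expSum (f : Module.End ℂ M) (n : ℕ) : Module.End ℂ M :=
  ∑ i ∈ Finset.range n, ((i.factorial : ℂ)⁻¹) • f ^ i

/-- A subspace `A` with `R ≤ A` whose image in `M/R` is a (two-sided) ideal. -/
def IsIdealAbove (br : M →ₗ[ℂ] M →ₗ[ℂ] M) (R A : Submodule ℂ M) : Prop :=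
  R ≤ A ∧ ∀ m a : M, a ∈ A → br m a ∈ A ∧ br a m ∈ A

/-- The derived series relative to `R` (computing the derived series of the image in `M/R`). -/
def derivedSeriesMod (br : M →ₗ[ℂ] M →ₗ[ℂ] M) (R U : Submodule ℂ M) : ℕ → Submodule ℂ M
  | 0 => U ⊔ R
  | n + 1 => Submodule.span ℂ
      {x | ∃ a ∈ derivedSeriesMod br R U n, ∃ b ∈ derivedSeriesMod br R U n, br a b = x} ⊔ R

/-- Solvability of the image of `U` in `M/R`. -/
def IsSolvableMod (br : M →ₗ[ℂ] M →ₗ[ℂ] M) (R U : Submodule ℂ M) : Prop :=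
  ∃ n : ℕ, derivedSeriesMod br R U n ≤ R

/-- `B/R` is the solvable radical of `M/R`. -/
def IsSolvableRadicalMod (br : M →ₗ[ℂ] M →ₗ[ℂ] M) (R B : Submodule ℂ M) : Prop :=
  IsIdealAbove br R B ∧ IsSolvableMod br R B ∧
    ∀ U : Submodule ℂ M, IsIdealAbove br R U → IsSolvableMod br R U → U ≤ B

/-- Semisimplicity of `L/R` as a Lie algebra, expressed via the standard characterization:
no ideal of `L/R` strictly between `R` and `L` is abelian, except the zero one. -/
def IsSemisimpleMod (br : M →ₗ[ℂ] M →ₗ[ℂ] M) (R L : Submodule ℂ M) : Prop :=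
  ∀ A : Submodule ℂ M, R ≤ A → A ≤ L →
    (∀ l ∈ L, ∀ a ∈ A, br l a ∈ A ∧ br a l ∈ A) →
    (∀ a ∈ A, ∀ b ∈ A, br a b ∈ R) → A = R

/-- The lower central series of `L` relative to `R`. -/
def lowerCentralSeriesMod (br : M →ₗ[ℂ] M →ₗ[ℂ] M) (R L : Submodule ℂ M) :
    ℕ → Submodule ℂ M
  | 0 => L ⊔ R
  | n + 1 => Submodule.span ℂ
      {x | ∃ a ∈ L, ∃ b ∈ lowerCentralSeriesMod br R L n, br a b = x} ⊔ R

/-- Nilpotency of `L/R`. -/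
def IsNilpotentMod (br : M →ₗ[ℂ] M →ₗ[ℂ] M) (R L : Submodule ℂ M) : Prop :=
  ∃ n : ℕ, lowerCentralSeriesMod br R L n ≤ R

/-- A totally isotropic subspace for the pairing `ψ(a,b) = [a,b] + [b,a]`. -/
def IsTotallyIsotropic (br : M →ₗ[ℂ] M →ₗ[ℂ] M) (U : Submodule ℂ M) : Prop :=
  ∀ a ∈ U, ∀ b ∈ U, br a b + br b a = 0

end LeibnizDefs

namespace LieModule

open LinearMap

variable (K L V : Type*) [Field K] [CharZero K] [LieRing L] [LieAlgebra K L]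
  [Module.Finite K L] [LieAlgebra.IsKilling K L]
  [AddCommGroup V] [Module K V] [LieRingModule L V] [LieModule K L V]

/-- The kernel of the trace form of a representation, as an ideal. -/
noncomputable def traceFormKer : LieIdeal K L :=
  LieAlgebra.InvariantForm.orthogonal (traceForm K L V) (traceForm_lieInvariant K L V) ⊤

omit [CharZero K] [Module.Finite K L] [LieAlgebra.IsKilling K L] in
lemma mem_traceFormKer {x : L} : x ∈ traceFormKer K L V ↔ ∀ y, traceForm K L V y x = 0 := by
  simp [traceFormKer, LieAlgebra.InvariantForm.mem_orthogonal]

/-- If the trace form of a representation is nonzero, the representation carries a Casimir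
operator: an equivariant endomorphism with nonzero trace and values in the span of the action. -/
theorem exists_casimir (h : traceForm K L V ≠ 0) :
    ∃ c : Module.End K V, (∀ (x : L) v, c ⁅x, v⁆ = ⁅x, c v⁆) ∧
      (∀ l : Module.Dual K V, (∀ (x : L) v, l ⁅x, v⁆ = 0) → ∀ v, l (c v) = 0) ∧
      trace K V c ≠ 0 := by
  classical
  set t := traceForm K L V with ht
  let I := traceFormKer K L V
  let J := I.killingCompl
  have hIJ : IsCompl I J := I.isCompl_killingCompl
  let tJ : LinearMap.BilinForm K J.toSubmodule := t.restrict J.toSubmodule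
  have hsym : tJ.IsSymm := ⟨fun x y => traceForm_comm K L V x y⟩
  have htI : ∀ x ∈ I, ∀ y, t y x = 0 := fun x hx => (mem_traceFormKer K L V).mp hx
  have hdec : ∀ y : L, ∃ u ∈ I, ∃ w ∈ J, u + w = y := fun y => by
    have : y ∈ I ⊔ J := by rw [hIJ.sup_eq_top]; trivial
    simpa [LieSubmodule.mem_sup] using this
  have hnd : tJ.Nondegenerate := by
    refine hsym.isRefl.nondegenerate_iff_separatingLeft.mpr ?_
    rintro ⟨x, hx⟩ hxy
    have hxI : x ∈ I := by
      refine (mem_traceFormKer K L V).mpr fun y => ?_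
      obtain ⟨u, hu, w, hw, rfl⟩ := hdec y
      rw [traceForm_comm, map_add]
      rw [← ht, htI u hu, zero_add]
      exact hxy ⟨w, hw⟩
    have : x ∈ I ⊓ J := ⟨hxI, hx⟩
    rw [hIJ.inf_eq_bot] at this
    simpa using this
  let b := Module.finBasis K J.toSubmodule
  let b' := tJ.dualBasis hnd b
  have hb : ∀ u ∈ J, u = ∑ j, t u (b' j) • (b j : L) := fun u hu => by
    have := congrArg J.toSubmodule.subtype ((tJ.dualBasis hnd b').sum_repr ⟨u, hu⟩)
    rw [map_sum] at this
    simp only [LinearMap.BilinForm.dualBasis_repr_apply, map_smul] at this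
    rw [LinearMap.BilinForm.dualBasis_dualBasis hnd hsym b] at this
    exact this.symm
  have hb' : ∀ u ∈ J, u = ∑ j, t u (b j) • (b' j : L) := fun u hu => by
    have := congrArg J.toSubmodule.subtype (b'.sum_repr ⟨u, hu⟩)
    rw [map_sum] at this
    simp only [b', LinearMap.BilinForm.dualBasis_repr_apply, map_smul] at this
    exact this.symm
  refine ⟨∑ i, toEnd K L V (b i) ∘ₗ toEnd K L V (b' i), fun x v => ?_, fun l hl v => ?_, ?_⟩
  · have h1 : ∀ i, ⁅x, (b i : L)⁆ = ∑ j, t ⁅x, (b i : L)⁆ (b' j) • (b j : L) := fun i =>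
      hb _ (lie_mem_right K L J x _ (b i).2)
    have h2 : ∀ i, ⁅x, (b' i : L)⁆ = ∑ j, -(t ⁅x, (b j : L)⁆ (b' i)) • (b' j : L) := fun i => by
      conv_lhs => rw [hb' _ (lie_mem_right K L J x _ (b' i).2)]
      refine Finset.sum_congr rfl fun j _ => ?_
      rw [ht, traceForm_apply_lie_apply', traceForm_comm]
    have key :
        ∑ i, ⁅⁅x, (b i : L)⁆, ⁅(b' i : L), v⁆⁆ + ∑ i, ⁅(b i : L), ⁅⁅x, (b' i : L)⁆, v⁆⁆ = 0 := by
      have e1 : ∑ i, ⁅⁅x, (b i : L)⁆, ⁅(b' i : L), v⁆⁆ =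
          ∑ i, ∑ j, t ⁅x, (b i : L)⁆ (b' j) • ⁅(b j : L), ⁅(b' i : L), v⁆⁆ := by
        refine Finset.sum_congr rfl fun i _ => ?_
        conv_lhs => rw [h1 i]
        simp only [sum_lie, smul_lie]
      have e2 : ∑ i, ⁅(b i : L), ⁅⁅x, (b' i : L)⁆, v⁆⁆ =
          ∑ i, ∑ j, -(t ⁅x, (b j : L)⁆ (b' i)) • ⁅(b i : L), ⁅(b' j : L), v⁆⁆ := by
        refine Finset.sum_congr rfl fun i _ => ?_
        conv_lhs => rw [h2 i]
        simp only [sum_lie, lie_sum, smul_lie, lie_smul]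
      rw [e1, e2, Finset.sum_comm, ← Finset.sum_add_distrib]
      refine Finset.sum_eq_zero fun i _ => ?_
      rw [← Finset.sum_add_distrib]
      exact Finset.sum_eq_zero fun j _ => by rw [neg_smul, add_neg_cancel]
    rw [← Finset.sum_add_distrib] at key
    simp only [LinearMap.sum_apply, comp_apply, toEnd_apply_apply, lie_sum]
    rw [← sub_eq_zero, ← neg_eq_zero, ← key, ← Finset.sum_sub_distrib, ← Finset.sum_neg_distrib]
    refine Finset.sum_congr rfl fun i _ => ?_
    rw [leibniz_lie x (b i : L), leibniz_lie x (b' i : L) v, lie_add]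
    abel
  · simp [hl]
  · rw [map_sum]
    have : ∀ i, trace K V (toEnd K L V (b i) ∘ₗ toEnd K L V (b' i)) = 1 := fun i => by
      have := LinearMap.BilinForm.apply_dualBasis_right hnd hsym b i i
      rwa [if_pos rfl] at this
    simp only [this, Finset.sum_const, Finset.card_univ, Fintype.card_fin, nsmul_eq_mul, mul_one,
      ne_eq, Nat.cast_eq_zero]
    intro h0
    have hJ : J.toSubmodule = ⊥ := Submodule.finrank_eq_zero.mp h0
    refine h (LinearMap.ext fun x => LinearMap.ext fun y => ?_)
    obtain ⟨u, hu, w, hw, rfl⟩ := hdec y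
    have : w = 0 := by
      have : w ∈ J.toSubmodule := hw
      simpa [hJ] using this
    simp [this, htI u hu]

omit [CharZero K] in
theorem lie_top_top_eq_top : ⁅(⊤ : LieIdeal K L), (⊤ : LieIdeal K L)⁆ = ⊤ := by
  set D := ⁅(⊤ : LieIdeal K L), (⊤ : LieIdeal K L)⁆ with hD
  suffices D.killingCompl = ⊥ by simpa [this] using D.isCompl_killingCompl.sup_eq_top
  rw [LieSubmodule.eq_bot_iff]
  intro x hx
  have hcenter : x ∈ LieAlgebra.center K L := by
    rw [mem_maxTrivSubmodule]
    intro y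
    refine (LieAlgebra.IsKilling.killingForm_nondegenerate K L).1 _ fun z => ?_
    rw [traceForm_apply_lie_apply', traceForm_comm, neg_eq_zero]
    exact (LieIdeal.mem_killingCompl K L D).mp hx _
      (LieSubmodule.lie_mem_lie (LieSubmodule.mem_top y) (LieSubmodule.mem_top z))
  simpa using hcenter

variable [Module.Finite K V]

/-- A representation with vanishing trace form is trivial. -/
theorem isTrivial_of_traceForm_eq_zero (h : traceForm K L V = 0) : IsTrivial L V := by
  have hn := isNilpotent_derivedSeries_of_traceForm_eq_zero h
  have hD : LieAlgebra.derivedSeries K L 1 = ⊤ := lie_top_top_eq_top K L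
  have hnil : IsNilpotent L V := by
    rw [isNilpotent_iff_forall' (R := K)] at hn ⊢
    exact fun x => hn ⟨x, by rw [hD]; trivial⟩
  set N := ⁅(⊤ : LieIdeal K L), (⊤ : LieSubmodule K L V)⁆ with hN
  have hstab : ⁅(⊤ : LieIdeal K L), N⁆ = N := by
    refine le_antisymm (LieSubmodule.lie_le_right _ _) ?_
    conv_lhs => rw [hN, ← lie_top_top_eq_top K L]
    rw [LieSubmodule.lieIdeal_oper_eq_span, LieSubmodule.lieSpan_le]
    rintro _ ⟨⟨x, hx⟩, ⟨v, -⟩, rfl⟩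
    have hmem : ∀ (y : L) (w : V), ⁅y, w⁆ ∈ N := fun y w =>
      LieSubmodule.lie_mem_lie (LieSubmodule.mem_top y) (LieSubmodule.mem_top w)
    have hmem' : ∀ (y z : L) (w : V), ⁅y, ⁅z, w⁆⁆ ∈ ⁅(⊤ : LieIdeal K L), N⁆ := fun y z w =>
      LieSubmodule.lie_mem_lie (LieSubmodule.mem_top y) (hmem z w)
    change ⁅x, v⁆ ∈ ⁅(⊤ : LieIdeal K L), N⁆
    have hx' := hx
    rw [← LieSubmodule.mem_toSubmodule, LieSubmodule.lieIdeal_oper_eq_linear_span'] at hx'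
    clear hN hx
    induction hx' using Submodule.span_induction with
    | mem x h =>
      obtain ⟨y, -, z, -, rfl⟩ := h
      rw [lie_lie]
      exact sub_mem (hmem' y z v) (hmem' z y v)
    | zero => simp
    | add x y _ _ ihx ihy => rw [add_lie]; exact add_mem ihx ihy
    | smul a x _ ih => rw [smul_lie]; exact SMulMemClass.smul_mem a ih
  have hlcs : ∀ k, lowerCentralSeries K L V (k + 1) = N := fun k => by
    induction k with
    | zero => rfl
    | succ k ih => rw [lowerCentralSeries_succ, ih, hstab]
  obtain ⟨k, hk⟩ := (isNilpotent_iff K L V).mp hnil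
  have hk' : N = ⊥ := by
    rw [← hlcs k, eq_bot_iff, ← hk]
    exact antitone_lowerCentralSeries K L V (Nat.le_succ k)
  refine ⟨fun x v => ?_⟩
  have : ⁅x, v⁆ ∈ N := LieSubmodule.lie_mem_lie (LieSubmodule.mem_top x) (LieSubmodule.mem_top v)
  simpa [hk'] using this

/-- An invariant linear form on a representation that does not vanish is nonzero on some
invariant vector. -/
theorem exists_invariant_apply_ne_zero (l : Module.Dual K V) (hl : ∀ (x : L) v, l ⁅x, v⁆ = 0)
    (hl0 : l ≠ 0) : ∃ v, (∀ x : L, ⁅x, v⁆ = 0) ∧ l v ≠ 0 := by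
  obtain ⟨N, hN, hmin⟩ := WellFounded.has_min
    (LieSubmodule.wellFoundedLT_of_isArtinian K L V).wf {N | ∃ v ∈ N, l v ≠ 0} <| by
      obtain ⟨v, hv⟩ : ∃ v, l v ≠ 0 := by
        by_contra! h
        exact hl0 (LinearMap.ext h)
      exact ⟨⊤, v, trivial, hv⟩
  by_cases ht : traceForm K L N = 0
  · have := isTrivial_of_traceForm_eq_zero K L N ht
    obtain ⟨v, hv, hlv⟩ := hN
    exact ⟨v, fun x => congrArg Subtype.val (trivial_lie_zero L N x ⟨v, hv⟩), hlv⟩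
  · exfalso
    obtain ⟨c, hc, hcl, htr⟩ := exists_casimir K L N ht
    obtain ⟨k, hk, hk1⟩ :=
      (c.eventually_isCompl_ker_pow_range_pow.and (Filter.eventually_ge_atTop 1)).exists
    have hck : ∀ (n : ℕ) (x : L) v, (c ^ n) ⁅x, v⁆ = ⁅x, (c ^ n) v⁆ := fun n x v => by
      induction n with
      | zero => rfl
      | succ n ih => rw [pow_succ', Module.End.mul_apply, Module.End.mul_apply, ih, hc]
    have hlk : ∀ v, l ((c ^ k) v) = 0 := fun v => by
      obtain ⟨n, rfl⟩ := Nat.exists_eq_add_of_le' hk1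
      rw [pow_succ', Module.End.mul_apply]
      exact hcl (l ∘ₗ N.toSubmodule.subtype) (fun x w => hl x w) _
    let P : LieSubmodule K L V :=
      { (ker (c ^ k)).map N.toSubmodule.subtype with
        lie_mem := by
          rintro x _ ⟨(v : N), hv, rfl⟩
          exact ⟨(⁅x, v⁆ : N), by simp [hck, mem_ker.mp hv], rfl⟩ }
    have hP : ∃ v ∈ P, l v ≠ 0 := by
      obtain ⟨v, hv, hlv⟩ := hN
      have hvtop : (⟨v, hv⟩ : N) ∈ ker (c ^ k) ⊔ range (c ^ k) := by
        rw [hk.sup_eq_top]; trivial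
      obtain ⟨u, hu, _, ⟨w, rfl⟩, huw⟩ := Submodule.mem_sup.mp hvtop
      refine ⟨u, ⟨u, hu, rfl⟩, fun hlu => hlv ?_⟩
      have : (u : V) + ((c ^ k) w : N) = v := congrArg Subtype.val huw
      rw [← this, map_add, hlu, hlk, add_zero]
    have hPN : P ≤ N := by
      rintro _ ⟨v, -, rfl⟩
      exact v.2
    have hNP : N ≤ P := (eq_of_le_of_not_lt hPN (hmin P hP)).ge
    refine htr (isNilpotent_trace_of_isNilpotent ⟨k, LinearMap.ext fun v => ?_⟩).eq_zero
    obtain ⟨u, hu, huv⟩ := hNP v.2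
    rw [← Subtype.ext huv]
    exact hu

end LieModule

namespace LieModule

variable {K L V : Type*} [Field K] [CharZero K] [LieRing L] [LieAlgebra K L]
  [Module.Finite K L] [LieAlgebra.IsKilling K L]
  [AddCommGroup V] [Module K V] [Module.Finite K V]

/-- A version of `LieModule.exists_invariant_apply_ne_zero` for an action that is only a
representation modulo an invariant subspace. -/
theorem exists_invariant_mod (ρ : L →ₗ[K] Module.End K V) (R : Submodule K V)
    (hR : ∀ x, ∀ r ∈ R, ρ x r ∈ R)
    (hρ : ∀ x y v, ρ ⁅x, y⁆ v - (ρ x (ρ y v) - ρ y (ρ x v)) ∈ R)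
    (l : Module.Dual K V) (hl : ∀ x v, l (ρ x v) = 0) (hlR : ∀ r ∈ R, l r = 0) (hl0 : l ≠ 0) :
    ∃ v, l v = 1 ∧ ∀ x, ρ x v ∈ R := by
  let _ : LieRingModule L (V ⧸ R) :=
    { bracket := fun x v => R.mapQ R (ρ x) (hR x) v
      add_lie := fun x y v => by
        induction v using Submodule.Quotient.induction_on with | _ v
        exact congrArg Submodule.Quotient.mk (by simp : ρ (x + y) v = ρ x v + ρ y v)
      lie_add := fun x v w => map_add _ v w
      leibniz_lie := fun x y v => by
        induction v using Submodule.Quotient.induction_on with | _ v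
        have := (Submodule.Quotient.mk_eq_zero R).mpr (hρ x y v)
        rw [Submodule.Quotient.mk_sub, sub_eq_zero, Submodule.Quotient.mk_sub,
          eq_sub_iff_add_eq] at this
        exact this.symm }
  have : LieModule K L (V ⧸ R) :=
    { smul_lie := fun t x v => by
        induction v using Submodule.Quotient.induction_on with | _ v
        exact congrArg Submodule.Quotient.mk (by simp : ρ (t • x) v = t • ρ x v)
      lie_smul := fun t x v => map_smul _ t v }
  have hlie : ∀ (x : L) (v : V), ⁅x, (Submodule.Quotient.mk v : V ⧸ R)⁆ =
    Submodule.Quotient.mk (ρ x v) := fun _ _ => rfl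
  let l' : Module.Dual K (V ⧸ R) := R.liftQ l fun r hr => hlR r hr
  obtain ⟨v, hv, hlv⟩ := exists_invariant_apply_ne_zero K L (V ⧸ R) l'
    (fun x v => by
      induction v using Submodule.Quotient.induction_on with | _ v
      rw [hlie]
      exact hl x v)
    (fun h => hl0 (LinearMap.ext fun v => LinearMap.congr_fun h (Submodule.Quotient.mk v)))
  induction v using Submodule.Quotient.induction_on with | _ v
  change l v ≠ 0 at hlv
  refine ⟨(l v)⁻¹ • v, by simp [hlv], fun x => ?_⟩
  rw [map_smul]
  exact R.smul_mem _ ((Submodule.Quotient.mk_eq_zero R).mp (hv x))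

end LieModule

section RestrictBracket

variable {M : Type*} [AddCommGroup M] [Module ℂ M]

/-- The restriction of a bilinear bracket to a subspace closed under it. -/
def restrictBracket (br : M →ₗ[ℂ] M →ₗ[ℂ] M) (S : Submodule ℂ M)
    (hS : ∀ a ∈ S, ∀ b ∈ S, br a b ∈ S) : S →ₗ[ℂ] S →ₗ[ℂ] S :=
  LinearMap.mk₂ ℂ (fun a b => ⟨br a b, hS a a.2 b b.2⟩)
    (fun a b c => by ext; simp) (fun c a b => by ext; simp)
    (fun a b c => by ext; simp) (fun c a b => by ext; simp)

theorem IsLeftLeibniz.restrictBracket {br : M →ₗ[ℂ] M →ₗ[ℂ] M} (hbr : IsLeftLeibniz br)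
    (S : Submodule ℂ M) (hS : ∀ a ∈ S, ∀ b ∈ S, br a b ∈ S) :
    IsLeftLeibniz (restrictBracket br S hS) :=
  fun a b c => Subtype.ext (hbr a b c)

end RestrictBracket

namespace IsLeftLeibniz

variable {M : Type*} [AddCommGroup M] [Module ℂ M] [FiniteDimensional ℂ M]
  {br : M →ₗ[ℂ] M →ₗ[ℂ] M}
  {L : Type*} [LieRing L] [LieAlgebra ℂ L] [FiniteDimensional ℂ L] [LieAlgebra.IsKilling ℂ L]

/-- An abelian extension of a semisimple Lie algebra has a linear section that is equivariant up to
inner corrections from the kernel. -/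
theorem exists_section_equivariant_mod (hbr : IsLeftLeibniz br) {f : M →ₗ[ℂ] L}
    (hf : Function.Surjective f) (hfbr : ∀ a b, f (br a b) = ⁅f a, f b⁆)
    (hker : ∀ a b, f a = 0 → f b = 0 → br a b = 0) :
    ∃ φ : L →ₗ[ℂ] M, (∀ y, f (φ y) = y) ∧
      ∀ m, ∃ k, f k = 0 ∧ ∀ y, br m (φ y) - φ ⁅f m, y⁆ = br k (φ y) := by
  obtain ⟨s, hs'⟩ := f.exists_rightInverse_of_surjective (LinearMap.range_eq_top.mpr hf)
  have hs : ∀ y, f (s y) = y := fun y => LinearMap.congr_fun hs' y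
  let E : Submodule ℂ ((L →ₗ[ℂ] M) × ℂ) :=
    { carrier := {p | ∀ y, f (p.1 y) = p.2 • y}
      add_mem' := fun {p q} hp hq y => by simp [hp y, hq y, add_smul]
      zero_mem' := fun y => by simp
      smul_mem' := fun c p hp y => by simp [hp y, mul_smul] }
  have hbrE : ∀ k, f k = 0 → ∀ p : E, ∀ y, br k (p.1.1 y) = br (p.1.2 • k) (s y) :=
    fun k hk p y => by
      have := hker k (p.1.1 y - p.1.2 • s y) hk (by simp [p.2 y, hs])
      rw [map_sub, sub_eq_zero] at this
      simp [this]
  let ρ : L →ₗ[ℂ] Module.End ℂ E := LinearMap.mk₂ ℂ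
    (fun x p => ⟨(br (s x) ∘ₗ p.1.1 - p.1.1 ∘ₗ (LieAlgebra.ad ℂ L x), 0), fun y => by
      simp [hfbr, hs, p.2 _]⟩)
    (fun x y p => by ext <;> simp; abel)
    (fun c x p => by ext <;> simp [smul_sub])
    (fun x p q => by ext <;> simp; abel)
    (fun c x p => by ext <;> simp [smul_sub])
  have hρ1 : ∀ x p y, (ρ x p).1.1 y = br (s x) (p.1.1 y) - p.1.1 ⁅x, y⁆ := fun _ _ _ => rfl
  have hρ2 : ∀ x p, (ρ x p).1.2 = 0 := fun _ _ => rfl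
  let R : Submodule ℂ E :=
    { carrier := {p | p.1.2 = 0 ∧ ∃ k, f k = 0 ∧ ∀ y, p.1.1 y = br k (s y)}
      add_mem' := by
        rintro p q ⟨hp, k, hk, hpk⟩ ⟨hq, k', hk', hqk⟩
        exact ⟨by simp [hp, hq], k + k', by simp [hk, hk'], fun y => by simp [hpk, hqk]⟩
      zero_mem' := ⟨rfl, 0, by simp, fun y => by simp⟩
      smul_mem' := by
        rintro c p ⟨hp, k, hk, hpk⟩
        exact ⟨by simp [hp], c • k, by simp [hk], fun y => by simp [hpk]⟩ }
  have hR : ∀ x, ∀ r ∈ R, ρ x r ∈ R := by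
    rintro x r ⟨hr, k, hk, hrk⟩
    refine ⟨rfl, br (s x) k, by simp [hfbr, hk], fun y => ?_⟩
    have := hker k (br (s x) (s y) - s ⁅x, y⁆) hk (by simp [hfbr, hs])
    rw [map_sub, sub_eq_zero] at this
    rw [hρ1, hrk, hrk, hbr, this, add_sub_cancel_right]
  have hρ : ∀ x y p, ρ ⁅x, y⁆ p - (ρ x (ρ y p) - ρ y (ρ x p)) ∈ R := fun x y p => by
    have hk : f (s ⁅x, y⁆ - br (s x) (s y)) = 0 := by simp [hfbr, hs]
    refine ⟨by simp [hρ2], p.1.2 • (s ⁅x, y⁆ - br (s x) (s y)), by rw [map_smul, hk, smul_zero],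
      fun z => ?_⟩
    rw [← hbrE _ hk p z]
    have h1 := hbr (s x) (s y) (p.1.1 z)
    simp only [Submodule.coe_sub, Prod.fst_sub, LinearMap.sub_apply, hρ1, map_sub, h1, lie_lie]
    abel
  let l : Module.Dual ℂ E := LinearMap.snd ℂ _ _ ∘ₗ E.subtype
  obtain ⟨p, hp1, hp⟩ := LieModule.exists_invariant_mod ρ R hR hρ l (fun x p => hρ2 x p)
    (fun r hr => hr.1) (fun h => by
      have : l ⟨(s, 1), fun y => by simp [hs]⟩ = 0 := by rw [h]; rfl
      exact one_ne_zero this)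
  replace hp1 : p.1.2 = 1 := hp1
  refine ⟨p.1.1, fun y => by rw [p.2 y, hp1, one_smul], fun m => ?_⟩
  obtain ⟨-, k, hk, hpk⟩ := hp (f m)
  have hm : f (m - s (f m)) = 0 := by simp [hs]
  refine ⟨k + (m - s (f m)), by rw [map_add, hk, hm, add_zero], fun y => ?_⟩
  have h1 := hpk y
  have h2 := hbrE k hk p y
  rw [hp1, one_smul] at h2
  rw [hρ1, ← h2] at h1
  rw [map_add, LinearMap.add_apply, ← h1]
  simp

/-- An abelian extension of a semisimple Lie algebra by a Leibniz algebra splits. -/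
theorem exists_hom_section_of_abelian_ker (hbr : IsLeftLeibniz br) {f : M →ₗ[ℂ] L}
    (hf : Function.Surjective f) (hfbr : ∀ a b, f (br a b) = ⁅f a, f b⁆)
    (hker : ∀ a b, f a = 0 → f b = 0 → br a b = 0) :
    ∃ φ : L →ₗ[ℂ] M, (∀ y, f (φ y) = y) ∧ ∀ x y, br (φ x) (φ y) = φ ⁅x, y⁆ := by
  obtain ⟨φ, hφ, hφm⟩ := hbr.exists_section_equivariant_mod hf hfbr hker
  let S : Submodule ℂ M :=
    { carrier := {m | ∀ y, br m (φ y) = φ ⁅f m, y⁆}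
      add_mem' := fun {a b} ha hb y => by simp [ha y, hb y]
      zero_mem' := fun y => by simp
      smul_mem' := fun c a ha y => by simp [ha y] }
  have hS : ∀ a ∈ S, ∀ b ∈ S, br a b ∈ S := fun a ha b hb y => by
    have h := hbr a b (φ y)
    rw [hb, ha, ha, hb] at h
    rw [hfbr, lie_lie, map_sub, h, add_sub_cancel_right]
  obtain ⟨ψ, hψ, hψm⟩ := (hbr.restrictBracket S hS).exists_section_equivariant_mod
    (f := f ∘ₗ S.subtype)
    (fun x => by
      obtain ⟨k, hk, hkm⟩ := hφm (φ x)
      refine ⟨⟨φ x - k, fun y => ?_⟩, by simp [hk, hφ]⟩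
      rw [map_sub, LinearMap.sub_apply, ← hkm, map_sub, hk]
      simp)
    (fun a b => hfbr a b)
    (fun a b ha hb => Subtype.ext (hker a b ha hb))
  refine ⟨S.subtype ∘ₗ ψ, hψ, fun x y => ?_⟩
  obtain ⟨k, hk, hkm⟩ := hψm (ψ x)
  have hk0 : br (k : M) (ψ y) = 0 := by
    have h1 := hker k (ψ y - φ y) hk (by
      rw [map_sub, hφ]
      exact sub_eq_zero.mpr (hψ y))
    rw [map_sub, sub_eq_zero] at h1
    rw [h1, k.2 y, show f k = 0 from hk, zero_lie, map_zero]
  have h := congrArg Subtype.val (hkm y)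
  have h' : br (ψ x : M) (ψ y) - ψ ⁅f (ψ x), y⁆ = br (k : M) (ψ y) := h
  rw [hk0, sub_eq_zero, show f (ψ x) = x from hψ x] at h'
  exact h'

end IsLeftLeibniz

namespace IsTwoSidedIdeal

variable {M : Type*} [AddCommGroup M] [Module ℂ M] {br : M →ₗ[ℂ] M →ₗ[ℂ] M} {D : Submodule ℂ M}

/-- The bracket induced on the quotient by a two-sided ideal. -/
def quotientBracket (hD : IsTwoSidedIdeal br D) : (M ⧸ D) →ₗ[ℂ] (M ⧸ D) →ₗ[ℂ] (M ⧸ D) :=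
  D.liftQ
    { toFun := fun m => D.mapQ D (br m) fun u hu => (hD m u hu).1
      map_add' := fun a b => by ext; simp
      map_smul' := fun c a => by ext; simp }
    fun u hu => by
      ext m
      exact (Submodule.Quotient.mk_eq_zero D).mpr (hD m u hu).2

theorem quotientBracket_mk (hD : IsTwoSidedIdeal br D) (a b : M) :
    hD.quotientBracket (D.mkQ a) (D.mkQ b) = D.mkQ (br a b) := rfl

theorem isLeftLeibniz_quotientBracket (hD : IsTwoSidedIdeal br D) (hbr : IsLeftLeibniz br) :
    IsLeftLeibniz hD.quotientBracket := fun a b c => by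
  obtain ⟨a, rfl⟩ := D.mkQ_surjective a
  obtain ⟨b, rfl⟩ := D.mkQ_surjective b
  obtain ⟨c, rfl⟩ := D.mkQ_surjective c
  simp only [quotientBracket_mk, ← map_add, hbr a b c]

theorem leibDerivedSeries (hD : IsTwoSidedIdeal br D) (hbr : IsLeftLeibniz br) (n : ℕ) :
    IsTwoSidedIdeal br (leibDerivedSeries br D n) := by
  induction n with
  | zero => exact hD
  | succ n ih =>
    intro m u hu
    induction hu using Submodule.span_induction with
    | mem u hu =>
      obtain ⟨a, ha, b, hb, rfl⟩ := hu
      have h1 : br m (br a b) ∈ _root_.leibDerivedSeries br D (n + 1) := by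
        rw [hbr]
        exact add_mem (subset_span ⟨_, (ih m a ha).1, b, hb, rfl⟩)
          (subset_span ⟨a, ha, _, (ih m b hb).1, rfl⟩)
      refine ⟨h1, ?_⟩
      rw [eq_sub_of_add_eq (hbr a b m).symm]
      exact sub_mem (subset_span ⟨a, ha, _, (ih m b hb).2, rfl⟩)
          (subset_span ⟨b, hb, _, (ih m a ha).2, rfl⟩)
    | zero => simp
    | add u v _ _ hu hv =>
      simp only [map_add, LinearMap.add_apply]
      exact ⟨add_mem hu.1 hv.1, add_mem hu.2 hv.2⟩
    | smul c u _ hu =>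
      simp only [map_smul, LinearMap.smul_apply]
      exact ⟨Submodule.smul_mem _ c hu.1, Submodule.smul_mem _ c hu.2⟩

theorem leibDerivedSeries_le (hD : IsTwoSidedIdeal br D) (n : ℕ) :
    _root_.leibDerivedSeries br D n ≤ D := by
  induction n with
  | zero => exact le_rfl
  | succ n ih =>
    refine span_le.mpr ?_
    rintro _ ⟨a, -, b, hb, rfl⟩
    exact (hD a b (ih hb)).1

end IsTwoSidedIdeal

section Solvable

variable {M : Type*} [AddCommGroup M] [Module ℂ M] {br : M →ₗ[ℂ] M →ₗ[ℂ] M}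

theorem leibDerivedSeries_mono {U V : Submodule ℂ M} (h : U ≤ V) (n : ℕ) :
    leibDerivedSeries br U n ≤ leibDerivedSeries br V n := by
  induction n with
  | zero => exact h
  | succ n ih =>
    refine span_mono ?_
    rintro _ ⟨a, ha, b, hb, rfl⟩
    exact ⟨a, ih ha, b, ih hb, rfl⟩

theorem leibDerivedSeries_succ' (U : Submodule ℂ M) (n : ℕ) :
    leibDerivedSeries br U (n + 1) = leibDerivedSeries br (leibDerivedSeries br U 1) n := by
  induction n with
  | zero => rfl
  | succ n ih => rw [leibDerivedSeries, ih]; rfl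

/-- An extension of a solvable space by an abelian one is solvable. -/
theorem IsLeibnizSolvable.of_br_mem {U V : Submodule ℂ M} (hU : IsLeibnizSolvable br U)
    (h : ∀ a ∈ V, ∀ b ∈ V, br a b ∈ U) : IsLeibnizSolvable br V := by
  obtain ⟨n, hn⟩ := hU
  refine ⟨n + 1, ?_⟩
  rw [leibDerivedSeries_succ', ← le_bot_iff, ← hn]
  refine leibDerivedSeries_mono (span_le.mpr ?_) n
  rintro _ ⟨a, ha, b, hb, rfl⟩
  exact h a ha b hb

theorem isLeibnizSolvable_bot : IsLeibnizSolvable br ⊥ := ⟨0, rfl⟩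

end Solvable

universe u

namespace IsLeftLeibniz

variable {M : Type*} [AddCommGroup M] [Module ℂ M] {br : M →ₗ[ℂ] M →ₗ[ℂ] M}

theorem br_br_self (hbr : IsLeftLeibniz br) (a m : M) : br (br a a) m = 0 := by
  simpa using hbr a a m

theorem isTwoSidedIdeal_leibnizKernel (hbr : IsLeftLeibniz br) :
    IsTwoSidedIdeal br (leibnizKernel br) := fun m u hu => by
  induction hu using Submodule.span_induction with
  | mem u hu =>
    obtain ⟨a, rfl⟩ := hu
    rw [hbr.br_br_self]
    refine ⟨?_, zero_mem _⟩
    have h : br m (br a a) = br (br m a + a) (br m a + a) - br (br m a) (br m a) - br a a := by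
      rw [hbr m a a]
      simp only [map_add, LinearMap.add_apply]
      abel
    rw [h]
    exact sub_mem (sub_mem (subset_span ⟨_, rfl⟩) (subset_span ⟨_, rfl⟩)) (subset_span ⟨_, rfl⟩)
  | zero => simp
  | add u v _ _ hu hv =>
    simp only [map_add, LinearMap.add_apply]
    exact ⟨add_mem hu.1 hv.1, add_mem hu.2 hv.2⟩
  | smul c u _ hu =>
    simp only [map_smul, LinearMap.smul_apply]
    exact ⟨Submodule.smul_mem _ c hu.1, Submodule.smul_mem _ c hu.2⟩

theorem br_eq_zero_of_mem_leibnizKernel (hbr : IsLeftLeibniz br) {u : M}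
    (hu : u ∈ leibnizKernel br) (m : M) : br u m = 0 := by
  induction hu using Submodule.span_induction with
  | mem u hu =>
    obtain ⟨a, rfl⟩ := hu
    exact hbr.br_br_self a m
  | zero => simp
  | add u v _ _ hu hv => simp [hu, hv]
  | smul c u _ hu => simp [hu]

theorem leibnizKernel_le (hbr : IsLeftLeibniz br) {B : Submodule ℂ M}
    (hB : IsSolvableRadical br B) : leibnizKernel br ≤ B :=
  hB.2.2 _ hbr.isTwoSidedIdeal_leibnizKernel <|
    isLeibnizSolvable_bot.of_br_mem fun _ ha b _ => hbr.br_eq_zero_of_mem_leibnizKernel ha b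

/-- The quotient of a Leibniz algebra by its solvable radical is a semisimple Lie algebra. -/
theorem exists_isKilling_quotient {M : Type u} [AddCommGroup M] [Module ℂ M]
    {br : M →ₗ[ℂ] M →ₗ[ℂ] M} [FiniteDimensional ℂ M] (hbr : IsLeftLeibniz br)
    {B : Submodule ℂ M} (hB : IsSolvableRadical br B) :
    ∃ (L : Type u) (_ : LieRing L) (_ : LieAlgebra ℂ L) (_ : FiniteDimensional ℂ L)
      (_ : LieAlgebra.IsKilling ℂ L) (f : M →ₗ[ℂ] L),
      Function.Surjective f ∧ (∀ a b, f (br a b) = ⁅f a, f b⁆) ∧ ∀ a, f a = 0 ↔ a ∈ B := by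
  let iR : LieRing (M ⧸ B) :=
    { (inferInstance : AddCommGroup (M ⧸ B)) with
      bracket := fun a b => hB.1.quotientBracket a b
      add_lie := fun a b c => by simp
      lie_add := fun a b c => by simp
      lie_self := fun a => by
        obtain ⟨a, rfl⟩ := B.mkQ_surjective a
        exact (Submodule.Quotient.mk_eq_zero B).mpr
          (hbr.leibnizKernel_le hB (subset_span ⟨a, rfl⟩))
      leibniz_lie := hB.1.isLeftLeibniz_quotientBracket hbr }
  let iA : LieAlgebra ℂ (M ⧸ B) :=
    { (inferInstance : Module ℂ (M ⧸ B)) with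
      lie_smul := fun c a b => map_smul (hB.1.quotientBracket a) c b }
  have hlie : ∀ a b : M, B.mkQ (br a b) = ⁅B.mkQ a, B.mkQ b⁆ := fun _ _ => rfl
  have : FiniteDimensional ℂ (M ⧸ B) := inferInstance
  have : LieAlgebra.HasTrivialRadical ℂ (M ⧸ B) := by
    rw [LieAlgebra.hasTrivialRadical_iff_no_abelian_ideals]
    intro I hI
    let U : Submodule ℂ M := I.toSubmodule.comap B.mkQ
    have hU : U ≤ B := by
      refine hB.2.2 U (fun m u hu => ⟨?_, ?_⟩) (hB.2.1.of_br_mem fun a ha b hb => ?_)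
      · exact lie_mem_right ℂ _ I (B.mkQ m) (B.mkQ u) hu
      · exact lie_mem_left ℂ _ I (B.mkQ u) (B.mkQ m) hu
      · rw [← Submodule.Quotient.mk_eq_zero]
        exact congrArg Subtype.val
          (hI.trivial (⟨B.mkQ a, ha⟩ : I) (⟨B.mkQ b, hb⟩ : I))
    rw [eq_bot_iff]
    intro x hx
    obtain ⟨a, rfl⟩ := B.mkQ_surjective x
    exact (Submodule.Quotient.mk_eq_zero B).mpr (hU hx)
  exact ⟨M ⧸ B, iR, iA, inferInstance, inferInstance, B.mkQ, B.mkQ_surjective, hlie,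
    fun a => Submodule.Quotient.mk_eq_zero B⟩

end IsLeftLeibniz

namespace IsLeftLeibniz

variable {L : Type*} [LieRing L] [LieAlgebra ℂ L] [FiniteDimensional ℂ L] [LieAlgebra.IsKilling ℂ L]

/-- An extension of a semisimple Lie algebra whose kernel is abelian modulo a two-sided ideal
splits modulo that ideal. -/
theorem exists_subalgebra_mem_of_map_eq_zero {M : Type*} [AddCommGroup M] [Module ℂ M]
    [FiniteDimensional ℂ M] {br : M →ₗ[ℂ] M →ₗ[ℂ] M} (hbr : IsLeftLeibniz br) {f : M →ₗ[ℂ] L}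
    (hf : Function.Surjective f) (hfbr : ∀ a b, f (br a b) = ⁅f a, f b⁆)
    {D : Submodule ℂ M} (hD : IsTwoSidedIdeal br D) (hDf : ∀ a ∈ D, f a = 0)
    (hker : ∀ a b, f a = 0 → f b = 0 → br a b ∈ D) :
    ∃ S : Submodule ℂ M, (∀ a ∈ S, ∀ b ∈ S, br a b ∈ S) ∧ (∀ y, ∃ a ∈ S, f a = y) ∧
      ∀ a ∈ S, f a = 0 → a ∈ D := by
  have hg : ∀ a, D.liftQ f hDf (D.mkQ a) = f a := fun _ => rfl
  obtain ⟨φ, hφ, hφbr⟩ := (hD.isLeftLeibniz_quotientBracket hbr).exists_hom_section_of_abelian_ker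
    (f := D.liftQ f hDf)
    (fun y => by
      obtain ⟨a, rfl⟩ := hf y
      exact ⟨D.mkQ a, rfl⟩)
    (fun a b => by
      obtain ⟨a, rfl⟩ := D.mkQ_surjective a
      obtain ⟨b, rfl⟩ := D.mkQ_surjective b
      exact hfbr a b)
    (fun a b ha hb => by
      obtain ⟨a, rfl⟩ := D.mkQ_surjective a
      obtain ⟨b, rfl⟩ := D.mkQ_surjective b
      exact (Submodule.Quotient.mk_eq_zero D).mpr (hker a b ha hb))
  refine ⟨(LinearMap.range φ).comap D.mkQ, ?_, fun y => ?_, ?_⟩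
  · rintro a ⟨x, hx⟩ b ⟨y, hy⟩
    refine ⟨⁅x, y⁆, ?_⟩
    rw [← hφbr, hx, hy, hD.quotientBracket_mk]
  · obtain ⟨a, ha⟩ := D.mkQ_surjective (φ y)
    refine ⟨a, ⟨y, ha.symm⟩, ?_⟩
    rw [← hg, ha, hφ]
  · rintro a ⟨x, hx⟩ ha
    have : x = 0 := by rw [← hφ x, hx, hg, ha]
    rw [← Submodule.Quotient.mk_eq_zero]
    change D.mkQ a = 0
    rw [← hx, this, map_zero]

/-- An extension of a semisimple Lie algebra by a Leibniz algebra splits modulo every term of the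
derived series of its kernel. -/
theorem exists_subalgebra_mem_leibDerivedSeries {M : Type*} [AddCommGroup M] [Module ℂ M]
    [FiniteDimensional ℂ M] {br : M →ₗ[ℂ] M →ₗ[ℂ] M} (hbr : IsLeftLeibniz br) {f : M →ₗ[ℂ] L}
    (hf : Function.Surjective f) (hfbr : ∀ a b, f (br a b) = ⁅f a, f b⁆)
    {B : Submodule ℂ M} (hB : IsTwoSidedIdeal br B) (hBf : ∀ a, f a = 0 ↔ a ∈ B) (n : ℕ) :
    ∃ S : Submodule ℂ M, (∀ a ∈ S, ∀ b ∈ S, br a b ∈ S) ∧ (∀ y, ∃ a ∈ S, f a = y) ∧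
      ∀ a ∈ S, f a = 0 → a ∈ leibDerivedSeries br B n := by
  induction n with
  | zero =>
    exact ⟨⊤, fun _ _ _ _ => mem_top, fun y => (hf y).imp fun a ha => ⟨mem_top, ha⟩,
      fun a _ ha => (hBf a).mp ha⟩
  | succ n ih =>
    obtain ⟨S, hS, hSf, hSB⟩ := ih
    obtain ⟨T, hT, hTf, hTB⟩ := (hbr.restrictBracket S hS).exists_subalgebra_mem_of_map_eq_zero
      (f := f ∘ₗ S.subtype) (D := (leibDerivedSeries br B (n + 1)).comap S.subtype)
      (fun y => by
        obtain ⟨a, ha, rfl⟩ := hSf y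
        exact ⟨⟨a, ha⟩, rfl⟩)
      (fun a b => hfbr a b)
      (fun m u hu => hB.leibDerivedSeries hbr (n + 1) m u hu)
      (fun a ha => (hBf a).mpr (hB.leibDerivedSeries_le (n + 1) ha))
      (fun a b ha hb => subset_span ⟨a, hSB a a.2 ha, b, hSB b b.2 hb, rfl⟩)
    refine ⟨T.map S.subtype, ?_, fun y => ?_, ?_⟩
    · rintro _ ⟨a, ha, rfl⟩ _ ⟨b, hb, rfl⟩
      exact ⟨_, hT a ha b hb, rfl⟩
    · obtain ⟨a, ha, rfl⟩ := hTf y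
      exact ⟨a, ⟨a, ha, rfl⟩, rfl⟩
    · rintro _ ⟨a, ha, rfl⟩ ha0
      exact hTB a ha ha0

end IsLeftLeibniz

/-- Every finite-dimensional complex left Leibniz algebra admits a Levi
decomposition `M = B(M) ⊕ S` with `S` a semisimple Lie subalgebra, `B(M)` the solvable
radical. -/
theorem leibniz_levi_decomposition (M : Type*) [AddCommGroup M] [Module ℂ M]
    [FiniteDimensional ℂ M] (br : M →ₗ[ℂ] M →ₗ[ℂ] M) (hleib : IsLeftLeibniz br)
    (B : Submodule ℂ M) (hB : IsSolvableRadical br B) :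
    ∃ S : Submodule ℂ M, IsLieSubalgebra br S ∧ IsSemisimpleSubalgebra br S ∧
      IsCompl B S := by
  obtain ⟨L, _, _, _, _, f, hf, hfbr, hfB⟩ := hleib.exists_isKilling_quotient hB
  obtain ⟨n, hn⟩ := hB.2.1
  obtain ⟨S, hS, hSf, hSB⟩ :=
    hleib.exists_subalgebra_mem_leibDerivedSeries hf hfbr hB.1 hfB n
  simp only [hn, mem_bot] at hSB
  have hdecomp : ∀ m, ∃ s ∈ S, m - s ∈ B := fun m => by
    obtain ⟨s, hs, hsm⟩ := hSf (f m)
    exact ⟨s, hs, by rw [← hfB, map_sub, hsm, sub_self]⟩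
  refine ⟨S, ⟨hS, fun a ha => hSB _ (hS a ha a ha) (by rw [hfbr, lie_self])⟩, ?_, ?_, ?_⟩
  · intro A hAS hA hA0
    have hU : A ⊔ B ≤ B := by
      refine hB.2.2 _ (fun m u hu => ?_) (hB.2.1.of_br_mem fun u hu v hv => ?_)
      · obtain ⟨a, ha, b, hb, rfl⟩ := mem_sup.mp hu
        obtain ⟨s, hs, hsm⟩ := hdecomp m
        have h1 : br m (a + b) = br s a + (br (m - s) a + br m b) := by simp; abel
        have h2 : br (a + b) m = br a s + (br a (m - s) + br b m) := by simp; abel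
        rw [h1, h2]
        exact ⟨add_mem_sup (hA s hs a ha).1 (add_mem (hB.1 _ _ hsm).2 (hB.1 _ _ hb).1),
          add_mem_sup (hA s hs a ha).2 (add_mem (hB.1 _ _ hsm).1 (hB.1 _ _ hb).2)⟩
      · obtain ⟨a, ha, b, hb, rfl⟩ := mem_sup.mp hu
        obtain ⟨a', ha', b', hb', rfl⟩ := mem_sup.mp hv
        have h : br (a + b) (a' + b') = br a b' + br b (a' + b') := by
          simp [hA0 a ha a' ha']
        rw [h]
        exact add_mem (hB.1 _ _ hb').1 (hB.1 _ _ hb).2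
    rw [eq_bot_iff]
    exact fun a ha => hSB a (hAS ha) ((hfB a).mpr (hU (mem_sup_left ha)))
  · rw [disjoint_def]
    exact fun a haB haS => hSB a haS ((hfB a).mpr haB)
  · rw [codisjoint_iff, eq_top_iff]
    intro m _
    obtain ⟨s, hs, hsm⟩ := hdecomp m
    rw [← sub_add_cancel m s]
    exact add_mem_sup hsm hs
end

section
/- Let S be a finite-dimensional complex semisimple Lie algebra, N a finite-dimensional left S-module, and M = S ⊕ N the left Leibniz algebra with bracket [(a,m),(b,n)] := ([a,b], a·n). Then a subspace S₁ ⊆ M satisfying M = S₁ ⊕ ({0} ⊕ N) is a Lie subalgebra of M (closed under the bracket with all self-brackets zero) if and only if S₁ = {(x, c(x)) : x ∈ S} for some morphism of left S-modules c : S → N, where S carries the adjoint action; in that case S₁ is isomorphic to S as a Lie algebra. -/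
open Submodule

/-- The first projection restricts to a linear equivalence on any complement of `0 × N`. -/
theorem exists_linearEquiv_eq_fst_of_isCompl {R S N : Type*} [Ring R] [AddCommGroup S] [Module R S]
    [AddCommGroup N] [Module R N] {p : Submodule R (S × N)}
    (h : IsCompl p (Submodule.prod (⊥ : Submodule R S) (⊤ : Submodule R N))) :
    ∃ e : p ≃ₗ[R] S, ∀ u : p, e u = u.1.1 := by
  refine ⟨LinearEquiv.ofBijective ((LinearMap.fst R S N).domRestrict p) ⟨?_, fun x => ?_⟩,
    fun u => rfl⟩
  · rw [injective_iff_map_eq_zero]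
    intro u hu
    exact Subtype.ext (Submodule.disjoint_def.mp h.disjoint u.1 u.2
      (Submodule.mem_prod.mpr ⟨hu, Submodule.mem_top⟩))
  · have hx : ((x, 0) : S × N) ∈ p ⊔ Submodule.prod ⊥ ⊤ := h.sup_eq_top ▸ Submodule.mem_top
    obtain ⟨u, hu, v, hv, huv⟩ := Submodule.mem_sup.mp hx
    have hv1 : v.1 = 0 := (Submodule.mem_prod.mp hv).1
    refine ⟨⟨u, hu⟩, ?_⟩
    simpa [hv1] using congrArg Prod.fst huv

/-- Let `S` be semisimple, `N` an `S`-module, and `M = S ⊕ N` the left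
Leibniz algebra with bracket `[(a,m),(b,n)] = ([a,b], a·n)`.  A complement `S₁` of
`{0} ⊕ N` is a Lie subalgebra iff it is the graph of a morphism `c : S → N` of
`S`-modules (with `S` the adjoint module); in that case `S₁ ≅ S` as Lie algebras. -/
theorem levi_subalgebras_are_graphs (S N : Type*) [LieRing S] [LieAlgebra ℂ S]
    [FiniteDimensional ℂ S] [LieAlgebra.IsSemisimple ℂ S]
    [AddCommGroup N] [Module ℂ N] [FiniteDimensional ℂ N]
    [LieRingModule S N] [LieModule ℂ S N]
    (br : (S × N) →ₗ[ℂ] (S × N) →ₗ[ℂ] (S × N))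
    (hbr : ∀ p q : S × N, br p q = (⁅p.1, q.1⁆, ⁅p.1, q.2⁆))
    (S₁ : Submodule ℂ (S × N))
    (hcompl : IsCompl S₁ (Submodule.prod (⊥ : Submodule ℂ S) (⊤ : Submodule ℂ N))) :
    (IsLieSubalgebra br S₁ ↔
      ∃ c : S →ₗ[ℂ] N, (∀ x y : S, c ⁅x, y⁆ = ⁅x, c y⁆) ∧ S₁ = LinearMap.graph c) ∧
    (IsLieSubalgebra br S₁ →
      ∃ e : S₁ ≃ₗ[ℂ] S, ∀ (u v : S₁) (h : br u.1 v.1 ∈ S₁),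
        e ⟨br u.1 v.1, h⟩ = ⁅e u, e v⁆) := by
  obtain ⟨e, he⟩ := exists_linearEquiv_eq_fst_of_isCompl hcompl
  refine ⟨⟨fun hL => ?_, ?_⟩, fun _ => ⟨e, fun u v h => by simp [he, hbr]⟩⟩
  · have hfst (x : S) : (e.symm x).1.1 = x := by rw [← he, e.apply_symm_apply]
    have hsnd (u : S × N) (hu : u ∈ S₁) : (e.symm u.1).1.2 = u.2 := by
      rw [← he ⟨u, hu⟩, e.symm_apply_apply]
    refine ⟨LinearMap.snd ℂ S N ∘ₗ S₁.subtype ∘ₗ e.symm.toLinearMap, fun x y => ?_, ?_⟩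
    · have hxy := hsnd _ (hL.1 _ (e.symm x).2 _ (e.symm y).2)
      simpa [hbr, hfst] using hxy
    · ext u
      refine ⟨fun hu => (hsnd u hu).symm, fun hu => ?_⟩
      have hu' : (e.symm u.1).1 = u := Prod.ext (hfst _) (Eq.symm hu)
      exact hu' ▸ (e.symm u.1).2
  · rintro ⟨c, hc, rfl⟩
    refine ⟨fun a ha b hb => ?_, fun a ha => ?_⟩
    · rw [LinearMap.mem_graph_iff] at hb ⊢
      simp [hbr, hb, hc]
    · rw [LinearMap.mem_graph_iff] at ha
      simp [hbr, ha, ← hc]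
end

section
/- Let S be a simple finite-dimensional complex Lie algebra and N a simple finite-dimensional left S-module that is not isomorphic to the adjoint module. Let M = S ⊕ N be the left Leibniz algebra with bracket [(a,m),(b,n)] := ([a,b], a·n). Then S ⊕ {0} is the unique Lie subalgebra S₁ of M with M = S₁ ⊕ ({0} ⊕ N). -/
open Submodule

/-- Schur's lemma: a morphism between non-isomorphic irreducible Lie modules vanishes. -/
theorem eq_zero_of_isEmpty_lieModuleEquiv {R L M N : Type*} [CommRing R] [LieRing L]
    [AddCommGroup M] [Module R M] [LieRingModule L M] [LieModule.IsIrreducible R L M]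
    [AddCommGroup N] [Module R N] [LieRingModule L N] [LieModule.IsIrreducible R L N]
    (h : IsEmpty (M ≃ₗ⁅R,L⁆ N)) (f : M →ₗ⁅R,L⁆ N) : f = 0 := by
  rcases eq_bot_or_eq_top f.ker with hker | hker
  · rcases eq_bot_or_eq_top f.range with hrange | hrange
    · ext m
      have hm : f m ∈ f.range := (LieModuleHom.mem_range f _).mpr ⟨m, rfl⟩
      simpa [hrange] using hm
    · have hinj := (LieModuleHom.ker_eq_bot f).mp hker
      have hsurj := (LieModuleHom.range_eq_top f).mp hrange
      exact h.elim { f, LinearEquiv.ofBijective f.toLinearMap ⟨hinj, hsurj⟩ with }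
  · ext m
    have hm : m ∈ f.ker := hker ▸ LieSubmodule.mem_top m
    simpa using hm

/-- If `S` is simple and `N` is a simple `S`-module not isomorphic to the
adjoint module, then `S ⊕ {0}` is the unique Lie subalgebra of `M = S ⊕ N` complementing
`{0} ⊕ N`. -/
theorem unique_levi_subalgebra (S N : Type*) [LieRing S] [LieAlgebra ℂ S]
    [FiniteDimensional ℂ S] [LieAlgebra.IsSimple ℂ S]
    [AddCommGroup N] [Module ℂ N] [FiniteDimensional ℂ N]
    [LieRingModule S N] [LieModule ℂ S N] [LieModule.IsIrreducible ℂ S N]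
    (hnotadj : IsEmpty (S ≃ₗ⁅ℂ,S⁆ N))
    (br : (S × N) →ₗ[ℂ] (S × N) →ₗ[ℂ] (S × N))
    (hbr : ∀ p q : S × N, br p q = (⁅p.1, q.1⁆, ⁅p.1, q.2⁆)) :
    (IsCompl (Submodule.prod (⊤ : Submodule ℂ S) (⊥ : Submodule ℂ N))
        (Submodule.prod (⊥ : Submodule ℂ S) (⊤ : Submodule ℂ N)) ∧
      IsLieSubalgebra br (Submodule.prod (⊤ : Submodule ℂ S) (⊥ : Submodule ℂ N))) ∧
    ∀ S₁ : Submodule ℂ (S × N),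
      IsCompl S₁ (Submodule.prod (⊥ : Submodule ℂ S) (⊤ : Submodule ℂ N)) →
      IsLieSubalgebra br S₁ →
      S₁ = Submodule.prod (⊤ : Submodule ℂ S) (⊥ : Submodule ℂ N) := by
  refine ⟨⟨?_, ?_, ?_⟩, ?_⟩
  · rw [isCompl_iff, disjoint_iff, codisjoint_iff, Submodule.prod_inf_prod,
      Submodule.prod_sup_prod]
    simp
  · rintro ⟨a, m⟩ ha ⟨b, n⟩ hb
    simp_all [Submodule.mem_prod]
  · rintro ⟨a, m⟩ ha
    simp_all [Submodule.mem_prod]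
  · rintro S₁ hS₁ ⟨hclosed, -⟩
    have hunique {s : S} {m n : N} (hm : (s, m) ∈ S₁) (hn : (s, n) ∈ S₁) : m = n := by
      have h := Submodule.disjoint_def.mp hS₁.disjoint _ (S₁.sub_mem hm hn)
        (by simp [Submodule.mem_prod])
      simpa [sub_eq_zero] using h
    have hexists (s : S) : ∃ n : N, (s, n) ∈ S₁ := by
      obtain ⟨⟨a, m⟩, h₁, ⟨b, n⟩, h₂, h⟩ := Submodule.mem_sup.mp
        (hS₁.sup_eq_top ▸ Submodule.mem_top : (s, (0 : N)) ∈ _)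
      obtain rfl : b = 0 := by simpa [Submodule.mem_prod] using h₂
      obtain rfl : a = s := by simpa using congrArg Prod.fst h
      exact ⟨m, h₁⟩
    choose φ hφ using hexists
    let f : S →ₗ⁅ℂ, S⁆ N :=
      { toFun := φ
        map_add' := fun s t => hunique (hφ _) (S₁.add_mem (hφ s) (hφ t))
        map_smul' := fun c s => hunique (hφ _) (S₁.smul_mem c (hφ s))
        map_lie' := fun {s t} => hunique (hφ _) (by
          simpa [hbr] using hclosed _ (hφ s) _ (hφ t)) }
    have hf : f = 0 := eq_zero_of_isEmpty_lieModuleEquiv hnotadj f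
    have hφ₀ (s : S) : (s, (0 : N)) ∈ S₁ := by
      have h : φ s = 0 := LieModuleHom.congr_fun hf s
      exact h ▸ hφ s
    ext ⟨s, n⟩
    simp only [Submodule.mem_prod, Submodule.mem_top, Submodule.mem_bot, true_and]
    exact ⟨fun h => hunique h (hφ₀ s), fun h => h ▸ hφ₀ s⟩
end

section
/- Let M be a finite-dimensional complex left Leibniz algebra with Leibniz kernel N = C(M) and solvable radical B = B(M). Let S be a Levi subalgebra of M, and suppose [S,N] = 0 (i.e., [s,n] = 0 for all s ∈ S, n ∈ N). Then for every subspace T ⊆ M that is a Lie subalgebra and is semisimple as a Lie algebra under the restricted bracket, there exists x ∈ [M,B] such that the exponential α = exp(ad_x) of the left adjoint map ad_x : b ↦ [x,b] is an automorphism of M with α(T) ⊆ S. -/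
open Submodule

open Module

attribute [local instance] LieRing.ofAssociativeRing

/-- The Casimir tensor `∑ bᵢ ⊗ dᵢ` of a nondegenerate form is annihilated by skew maps. -/
lemma sum_apply_dualBasis_add_eq_zero {ι J V : Type*} [Fintype ι] [DecidableEq ι] [AddCommGroup J]
    [Module ℂ J] [AddCommGroup V] [Module ℂ V] (β : LinearMap.BilinForm ℂ J)
    [FiniteDimensional ℂ J] (hβ : β.Nondegenerate) (hs : β.IsSymm) (b : Basis ι ℂ J) (D : J →ₗ[ℂ] J)
    (hD : ∀ u v, β (D u) v = - β u (D v)) (Φ : J →ₗ[ℂ] J →ₗ[ℂ] V) :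
    ∑ i, (Φ (D (b i)) (β.dualBasis hβ b i) + Φ (b i) (D (β.dualBasis hβ b i))) = 0 := by
  set d := β.dualBasis hβ b with hd
  have h1 (v : J) : v = ∑ j, β v (b j) • d j := by
    conv_lhs => rw [← d.sum_repr v]
    simp [hd, LinearMap.BilinForm.dualBasis_repr_apply]
  have h2 (v : J) : v = ∑ j, β v (d j) • b j := by
    conv_lhs => rw [← b.sum_repr v]
    refine Finset.sum_congr rfl fun j _ => ?_
    conv_rhs => rw [← b.sum_repr v]
    simp only [hd, map_sum, map_smul, LinearMap.sum_apply, LinearMap.smul_apply,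
      LinearMap.BilinForm.apply_dualBasis_right hβ hs]
    simp
  have e1 (i : ι) : Φ (D (b i)) (d i) = ∑ j, β (D (b i)) (d j) • Φ (b j) (d i) := by
    conv_lhs => rw [h2 (D (b i))]
    simp
  have e2 (i : ι) : Φ (b i) (D (d i)) = ∑ j, β (D (d i)) (b j) • Φ (b i) (d j) := by
    conv_lhs => rw [h1 (D (d i))]
    simp
  simp_rw [Finset.sum_add_distrib, e1, e2]
  rw [Finset.sum_comm, ← Finset.sum_add_distrib]
  refine Finset.sum_eq_zero fun i _ => ?_
  rw [← Finset.sum_add_distrib]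
  refine Finset.sum_eq_zero fun j _ => ?_
  rw [← add_smul, hD, hs.eq (D (d i)), neg_add_cancel, zero_smul]

/-- A semisimple Lie algebra is perfect. -/
lemma lie_top_eq_top {L : Type*} [LieRing L] [LieAlgebra ℂ L] [FiniteDimensional ℂ L]
    [LieAlgebra.HasTrivialRadical ℂ L] : ⁅(⊤ : LieIdeal ℂ L), (⊤ : LieIdeal ℂ L)⁆ = ⊤ := by
  set J : LieIdeal ℂ L := ⁅(⊤ : LieIdeal ℂ L), (⊤ : LieIdeal ℂ L)⁆ with hJ
  have hc : IsCompl J J.killingCompl := J.isCompl_killingCompl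
  have hab : IsLieAbelian J.killingCompl := by
    rw [LieSubmodule.lie_abelian_iff_lie_self_eq_bot, eq_bot_iff, ← hc.inf_eq_bot]
    exact le_inf (LieSubmodule.mono_lie le_top le_top) (LieSubmodule.lie_le_right _ _)
  have := (LieAlgebra.hasTrivialRadical_iff_no_abelian_ideals ℂ L).1 inferInstance _ hab
  simpa [this] using hc.sup_eq_top

section
variable {L V : Type*} [LieRing L] [LieAlgebra ℂ L] [FiniteDimensional ℂ L]
    [LieAlgebra.HasTrivialRadical ℂ L] [AddCommGroup V] [Module ℂ V] [FiniteDimensional ℂ V]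
    [LieRingModule L V] [LieModule ℂ L V]

lemma isTrivial_of_traceForm_eq_zero [LieModule.IsIrreducible ℂ L V]
    (h : LieModule.traceForm ℂ L V = 0) : LieModule.IsTrivial L V := by
  have hn := LieModule.isNilpotent_derivedSeries_of_traceForm_eq_zero h
  have : LieAlgebra.derivedSeries ℂ L 1 = ⊤ := by
    simp [lie_top_eq_top]
  have hn : LieModule.IsNilpotent L V := by
    rw [LieModule.isNilpotent_iff_forall' (R := ℂ)] at hn ⊢
    exact fun x => hn ⟨x, by rw [this]; trivial⟩
  have := LieModule.nontrivial_of_isIrreducible ℂ L V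
  have := LieModule.nontrivial_max_triv_of_isNilpotent ℂ L V
  have h := LieSubmodule.eq_top_of_isIrreducible ℂ L V (LieModule.maxTrivSubmodule ℂ L V)
  exact (LieModule.isTrivial_iff_max_triv_eq_top ℂ L V).2 h

omit [FiniteDimensional ℂ V] in
lemma exists_lieIdeal_traceForm_nondegenerate (h : LieModule.traceForm ℂ L V ≠ 0) :
    ∃ J : LieIdeal ℂ L, J ≠ ⊥ ∧
      LinearMap.BilinForm.Nondegenerate ((LieModule.traceForm ℂ L V).restrict J.toSubmodule) := by
  let K : LieIdeal ℂ L := LieAlgebra.InvariantForm.orthogonal (LieModule.traceForm ℂ L V)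
    (LieModule.traceForm_lieInvariant ℂ L V) ⊤
  have hK (y : L) : y ∈ K ↔ ∀ x, LieModule.traceForm ℂ L V x y = 0 := by
    simp [K, LieAlgebra.InvariantForm.mem_orthogonal]
  have hc : IsCompl K K.killingCompl := K.isCompl_killingCompl
  refine ⟨K.killingCompl, fun hJ => h ?_, ?_⟩
  · have hT : K = ⊤ := by simpa [hJ] using hc.sup_eq_top
    ext x y
    exact (hK y).1 (hT ▸ LieSubmodule.mem_top y) x
  · refine (LinearMap.IsRefl.nondegenerate_iff_separatingLeft ?_).2 ?_
    rotate_left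
    · rintro ⟨x, hx⟩ hxJ
      have : x ∈ K ⊓ K.killingCompl := by
        refine ⟨(hK x).2 fun y => ?_, hx⟩
        have hy : y ∈ K ⊔ K.killingCompl := by rw [hc.sup_eq_top]; trivial
        obtain ⟨k, hk, j, hj, rfl⟩ := (LieSubmodule.mem_sup _ _ _).1 hy
        rw [map_add, LinearMap.add_apply, LieModule.traceForm_comm, (hK k).1 hk, zero_add,
          LieModule.traceForm_comm]
        exact hxJ ⟨j, hj⟩
      rw [hc.inf_eq_bot] at this
      exact Subtype.ext (by simpa using this)
    · intro x y hxy
      exact (LieModule.traceForm_comm ℂ L V y.1 x.1).trans hxy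

/-- First Whitehead lemma, irreducible case. -/
lemma exists_eq_lie_of_isIrreducible [LieModule.IsIrreducible ℂ L V] (f : L →ₗ[ℂ] V)
    (hf : ∀ x y, f ⁅x, y⁆ = ⁅x, f y⁆ - ⁅y, f x⁆) : ∃ v : V, ∀ x, f x = ⁅x, v⁆ := by
  classical
  by_cases h0 : LieModule.traceForm ℂ L V = 0
  · have := isTrivial_of_traceForm_eq_zero h0
    refine ⟨0, fun x => ?_⟩
    have hx : x ∈ ⁅(⊤ : LieIdeal ℂ L), (⊤ : LieIdeal ℂ L)⁆ := by rw [lie_top_eq_top]; trivial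
    rw [← LieSubmodule.mem_toSubmodule, LieSubmodule.lieIdeal_oper_eq_linear_span'] at hx
    rw [lie_zero]
    induction hx using Submodule.span_induction with
    | mem x h => obtain ⟨a, -, b, -, rfl⟩ := h; simp [hf, LieModule.IsTrivial.trivial]
    | zero => simp
    | add x y _ _ hx hy => simp [hx, hy]
    | smul c x _ hx => simp [hx]
  obtain ⟨J, hJ, hβ⟩ := exists_lieIdeal_traceForm_nondegenerate h0
  set β := (LieModule.traceForm ℂ L V).restrict J.toSubmodule
  have hs : β.IsSymm := ⟨fun x y => LieModule.traceForm_comm ℂ L V x y⟩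
  let b := Module.finBasis ℂ J
  let d := LinearMap.BilinForm.dualBasis β hβ b
  have key {U : Type _} [AddCommGroup U] [Module ℂ U] (x : L) (Φ : L →ₗ[ℂ] L →ₗ[ℂ] U) :
      ∑ i, (Φ ⁅x, (b i : L)⁆ (d i) + Φ (b i) ⁅x, (d i : L)⁆) = 0 := by
    exact sum_apply_dualBasis_add_eq_zero β hβ hs b (LieModule.toEnd ℂ L J x)
      (fun u v => LieModule.traceForm_apply_lie_apply' ℂ L V x u v)
      (Φ.compl₁₂ J.toSubmodule.subtype J.toSubmodule.subtype)
  let ρ := LieModule.toEnd ℂ L V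
  let C : Module.End ℂ V := ∑ i, ρ (b i) * ρ (d i)
  have hCapp (v : V) : C v = ∑ i, ⁅(b i : L), ⁅(d i : L), v⁆⁆ := by
    simp [C, ρ]
  have hcomm (x : L) (v : V) : C ⁅x, v⁆ = ⁅x, C v⁆ := by
    have h := key x ((LinearMap.mul ℂ (Module.End ℂ V)).compl₁₂ ρ.toLinearMap ρ.toLinearMap)
    have h := congrArg (fun g => g v) h
    simp only [LinearMap.compl₁₂_apply, LieHom.coe_toLinearMap, LinearMap.mul_apply',
      LinearMap.sum_apply, LinearMap.add_apply, Module.End.mul_apply, ρ,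
      LieModule.toEnd_apply_apply, LinearMap.zero_apply] at h
    rw [hCapp, hCapp, lie_sum, eq_comm, ← sub_eq_zero, ← Finset.sum_sub_distrib, ← h]
    refine Finset.sum_congr rfl fun i _ => ?_
    rw [leibniz_lie x (b i : L), leibniz_lie x (d i : L), lie_add]
    abel
  have htr : LinearMap.trace ℂ V C = Module.finrank ℂ J := by
    have (i : _) : LinearMap.trace ℂ V (ρ (b i) * ρ (d i)) = 1 := by
      change β (b i) (d i) = 1
      simp [d, LinearMap.BilinForm.apply_dualBasis_right hβ hs]
    simp [C, this]
  have hJ0 : Module.finrank ℂ J ≠ 0 := by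
    have : Nontrivial J := (LieSubmodule.nontrivial_iff_ne_bot ℂ L L).2 hJ
    exact Module.finrank_pos.ne'
  let N : LieSubmodule ℂ L V :=
    { LinearMap.ker C with
      lie_mem := fun {x m} hm => by
        have hm : C m = 0 := hm
        change C ⁅x, m⁆ = 0
        rw [hcomm, hm, lie_zero] }
  have hN : N = ⊥ := by
    refine (eq_bot_or_eq_top N).resolve_right fun hN => hJ0 ?_
    have : C = 0 := by
      ext v
      exact (hN ▸ LieSubmodule.mem_top v : v ∈ N)
    rw [this, map_zero] at htr
    exact_mod_cast htr.symm
  have hinj : Function.Injective C := by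
    rw [← LinearMap.ker_eq_bot, eq_bot_iff]
    intro v hv
    have : v ∈ N := hv
    rw [hN] at this
    simpa using this
  obtain ⟨v, hv⟩ := (LinearMap.injective_iff_surjective.1 hinj) (∑ i, ⁅(b i : L), f (d i)⁆)
  refine ⟨v, fun x => hinj ?_⟩
  rw [hcomm, hv, hCapp, lie_sum, eq_comm, ← sub_eq_zero, ← Finset.sum_sub_distrib]
  have h := key x (ρ.toLinearMap.compl₂ f)
  simp only [LinearMap.compl₂_apply, LieHom.coe_toLinearMap, ρ,
      LieModule.toEnd_apply_apply] at h
  rw [← h]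
  refine Finset.sum_congr rfl fun i _ => ?_
  rw [leibniz_lie x (b i : L), hf x, lie_sub]
  abel

/-- First Whitehead lemma. -/
theorem exists_eq_lie_of_cocycle (f : L →ₗ[ℂ] V)
    (hf : ∀ x y, f ⁅x, y⁆ = ⁅x, f y⁆ - ⁅y, f x⁆) : ∃ v : V, ∀ x, f x = ⁅x, v⁆ := by
  induction hn : Module.finrank ℂ V using Nat.strong_induction_on generalizing V with
  | _ n ih =>
  subst hn
  rcases subsingleton_or_nontrivial V with hV | hV
  · exact ⟨0, fun x => Subsingleton.elim _ _⟩
  by_cases hirr : LieModule.IsIrreducible ℂ L V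
  · exact exists_eq_lie_of_isIrreducible f hf
  obtain ⟨W, hWb, hWt⟩ : ∃ W : LieSubmodule ℂ L V, W ≠ ⊥ ∧ W ≠ ⊤ := by
    by_contra! h
    exact hirr (LieModule.IsIrreducible.mk h)
  have hWb' : W.toSubmodule ≠ ⊥ := by simpa using hWb
  have hWt' : W.toSubmodule ≠ ⊤ := by simpa using hWt
  have hlt : finrank ℂ (V ⧸ W) < finrank ℂ V := by
    have h1 := W.toSubmodule.finrank_quotient_add_finrank
    have h2 := Submodule.one_le_finrank_iff.2 hWb'
    change finrank ℂ (V ⧸ W.toSubmodule) < _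
    omega
  let π := LieSubmodule.Quotient.mk' W
  obtain ⟨u, hu⟩ := ih _ hlt (V := V ⧸ W) (π.toLinearMap ∘ₗ f) (fun x y => by
    change π (f ⁅x, y⁆) = ⁅x, π (f y)⁆ - ⁅y, π (f x)⁆
    rw [hf, map_sub, LieModuleHom.map_lie, LieModuleHom.map_lie]) rfl
  obtain ⟨u, rfl⟩ := LieSubmodule.Quotient.surjective_mk' W u
  have hg (x : L) : f x - ⁅x, u⁆ ∈ W := by
    rw [← LieSubmodule.Quotient.mk_eq_zero, map_sub, sub_eq_zero, LieModuleHom.map_lie]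
    exact hu x
  let g : L →ₗ[ℂ] W := LinearMap.codRestrict W.toSubmodule
    (f - (LieModule.toEnd ℂ L V).toLinearMap.flip u) hg
  have hgx (x : L) : (g x : V) = f x - ⁅x, u⁆ := rfl
  obtain ⟨w, hw⟩ := ih _ (Submodule.finrank_lt hWt') (V := W) g
    (fun x y => by
      ext
      rw [LieSubmodule.coe_sub, LieSubmodule.coe_bracket, LieSubmodule.coe_bracket, hgx, hgx, hgx,
        hf, lie_lie, lie_sub, lie_sub]
      abel) rfl
  refine ⟨u + w, fun x => ?_⟩
  rw [lie_add, ← LieSubmodule.coe_bracket, ← hw, hgx]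
  abel

/-- A cocycle modulo `W` with values in `U` is a coboundary modulo `W`. -/
lemma exists_sub_lie_mem_of_cocycle (U W : LieSubmodule ℂ L V) (f : L →ₗ[ℂ] V)
    (hfU : ∀ x, f x ∈ U) (hf : ∀ x y, f ⁅x, y⁆ - (⁅x, f y⁆ - ⁅y, f x⁆) ∈ W) :
    ∃ v ∈ U, ∀ x, f x - ⁅x, v⁆ ∈ W := by
  let π := LieSubmodule.Quotient.mk' W
  let g : L →ₗ[ℂ] U.map π := LinearMap.codRestrict (U.map π).toSubmodule (π.toLinearMap ∘ₗ f)
    fun x => ⟨f x, hfU x, rfl⟩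
  have hgx (x : L) : (g x : V ⧸ W) = π (f x) := rfl
  obtain ⟨⟨_, v, hv, rfl⟩, h⟩ := exists_eq_lie_of_cocycle g fun x y => by
    ext
    rw [LieSubmodule.coe_sub, LieSubmodule.coe_bracket, LieSubmodule.coe_bracket, hgx, hgx, hgx,
      ← LieModuleHom.map_lie, ← LieModuleHom.map_lie, ← map_sub, ← sub_eq_zero, ← map_sub]
    exact (LieSubmodule.Quotient.mk_eq_zero _).2 (hf x y)
  refine ⟨v, hv, fun x => ?_⟩
  have h := congrArg Subtype.val (h x)
  rw [hgx, LieSubmodule.coe_bracket] at h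
  rw [← LieSubmodule.Quotient.mk_eq_zero, map_sub, sub_eq_zero, LieModuleHom.map_lie]
  exact h

end

/-- If `I` is a solvable ideal of `g`, then `⁅g, I⁆` acts nilpotently on every finite-dimensional
`g`-module. -/
lemma isNilpotent_toEnd_of_mem_lie {g V : Type*} [LieRing g] [LieAlgebra ℂ g]
    [FiniteDimensional ℂ g] [AddCommGroup V] [Module ℂ V] [FiniteDimensional ℂ V]
    [LieRingModule g V] [LieModule ℂ g V] (I : LieIdeal ℂ g) [LieAlgebra.IsSolvable I]
    {x : g} (hx : x ∈ ⁅(⊤ : LieIdeal ℂ g), I⁆) : IsNilpotent (LieModule.toEnd ℂ g V x) := by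
  induction hn : finrank ℂ V using Nat.strong_induction_on generalizing V with
  | _ n ih =>
  subst hn
  rcases subsingleton_or_nontrivial V with hV | hV
  · exact ⟨0, Subsingleton.elim _ _⟩
  by_cases hirr : LieModule.IsIrreducible ℂ g V
  · obtain ⟨χ, hχ⟩ := LieModule.exists_nontrivial_weightSpace_of_isSolvable ℂ I V
    let N : LieSubmodule ℂ g V := LieModule.weightSpaceOfIsLieTower ℂ V χ
    replace hχ : Nontrivial N := hχ
    replace hχ : N = ⊤ := N.eq_top_of_isIrreducible ℂ g V
    have hsc (y : g) (hy : y ∈ I) : LieModule.toEnd ℂ g V y = χ ⟨y, hy⟩ • LinearMap.id := by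
      ext m
      have hm : ∀ (y : g) (hy : y ∈ I), ⁅y, m⁆ = χ ⟨y, hy⟩ • m := by
        simpa [N, LieModule.weightSpaceOfIsLieTower, LieModule.mem_weightSpace] using
          (hχ ▸ LieSubmodule.mem_top m : m ∈ N)
      simpa using hm y hy
    have hz : LieModule.toEnd ℂ g V x = 0 := by
      clear ih
      rw [← LieSubmodule.mem_toSubmodule, LieSubmodule.lieIdeal_oper_eq_linear_span'] at hx
      induction hx using Submodule.span_induction with
      | mem x h =>
        obtain ⟨a, -, b, hb, rfl⟩ := h
        rw [LieHom.map_lie, hsc b hb, lie_smul]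
        have : ⁅LieModule.toEnd ℂ g V a, (LinearMap.id : End ℂ V)⁆ = 0 :=
          (LieModule.toEnd ℂ g V a).commute_id_right.lie_eq
        rw [this, smul_zero]
      | zero => simp
      | add x y _ _ hx hy => simp [hx, hy]
      | smul c x _ hx => simp [hx]
    rw [hz]
    exact IsNilpotent.zero
  obtain ⟨W, hWb, hWt⟩ : ∃ W : LieSubmodule ℂ g V, W ≠ ⊥ ∧ W ≠ ⊤ := by
    by_contra! h
    exact hirr (LieModule.IsIrreducible.mk h)
  have hWb' : W.toSubmodule ≠ ⊥ := by simpa using hWb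
  have hWt' : W.toSubmodule ≠ ⊤ := by simpa using hWt
  have hlt : finrank ℂ (V ⧸ W) < finrank ℂ V := by
    have h1 := W.toSubmodule.finrank_quotient_add_finrank
    have h2 := Submodule.one_le_finrank_iff.2 hWb'
    change finrank ℂ (V ⧸ W.toSubmodule) < _
    omega
  obtain ⟨p, hp⟩ := ih _ hlt (V := V ⧸ W) rfl
  obtain ⟨q, hq⟩ := ih _ (Submodule.finrank_lt hWt') (V := W) rfl
  have hπ (j : ℕ) (v : V) : LieSubmodule.Quotient.mk' W ((LieModule.toEnd ℂ g V x ^ j) v) =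
      (LieModule.toEnd ℂ g (V ⧸ W) x ^ j) (LieSubmodule.Quotient.mk' W v) := by
    induction j generalizing v with
    | zero => simp
    | succ j ih => simp [pow_succ, ih]
  have hι (j : ℕ) (w : W) : (LieModule.toEnd ℂ g V x ^ j) (w : V) =
      ((LieModule.toEnd ℂ g W x ^ j) w : W) := by
    induction j generalizing w with
    | zero => simp
    | succ j ih => simp [pow_succ, ← ih]
  refine ⟨q + p, LinearMap.ext fun v => ?_⟩
  have hv : (LieModule.toEnd ℂ g V x ^ p) v ∈ W := by
    rw [← LieSubmodule.Quotient.mk_eq_zero, hπ, hp, LinearMap.zero_apply]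
  rw [pow_add, Module.End.mul_apply, hι q ⟨_, hv⟩, hq]
  simp

lemma isNilpotent_lie_of_isSolvable {g V : Type*} [LieRing g] [LieAlgebra ℂ g]
    [FiniteDimensional ℂ g] [AddCommGroup V] [Module ℂ V] [FiniteDimensional ℂ V]
    [LieRingModule g V] [LieModule ℂ g V] (I : LieIdeal ℂ g) [LieAlgebra.IsSolvable I] :
    LieModule.IsNilpotent (⁅(⊤ : LieIdeal ℂ g), I⁆ : LieIdeal ℂ g) V := by
  rw [LieModule.isNilpotent_iff_forall' (R := ℂ)]
  exact fun x => isNilpotent_toEnd_of_mem_lie I x.2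

section
variable {M : Type*} [AddCommGroup M] [Module ℂ M] {br : M →ₗ[ℂ] M →ₗ[ℂ] M}

lemma lie_leftMul (hleib : IsLeftLeibniz br) (a b : M) :
    (⁅br a, br b⁆ : Module.End ℂ M) = br (br a b) := by
  refine LinearMap.ext fun c => ?_
  rw [LieRing.of_associative_ring_bracket, LinearMap.sub_apply, Module.End.mul_apply,
    Module.End.mul_apply, hleib a b c, add_sub_cancel_right]

/-- The Lie algebra of left multiplications of a left Leibniz algebra. -/
def leftMulLieSubalgebra (hleib : IsLeftLeibniz br) : LieSubalgebra ℂ (Module.End ℂ M) where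
  __ := LinearMap.range br
  lie_mem' := by
    rintro _ _ ⟨a, rfl⟩ ⟨b, rfl⟩
    exact ⟨br a b, (lie_leftMul hleib a b).symm⟩

/-- The left multiplications by elements of a two-sided ideal. -/
def leftMulLieIdeal (hleib : IsLeftLeibniz br) {B : Submodule ℂ M}
    (hB : IsTwoSidedIdeal br B) : LieIdeal ℂ (leftMulLieSubalgebra hleib) where
  __ := (B.map br).comap (leftMulLieSubalgebra hleib).toSubmodule.subtype
  lie_mem := by
    rintro ⟨_, a, rfl⟩ ⟨_, _⟩ ⟨b, hb, rfl⟩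
    exact ⟨br a b, (hB a b hb).1, (lie_leftMul hleib a b).symm⟩

lemma isSolvable_leftMulLieIdeal (hleib : IsLeftLeibniz br) {B : Submodule ℂ M}
    (hB : IsTwoSidedIdeal br B) (hBs : IsLeibnizSolvable br B) :
    LieAlgebra.IsSolvable (leftMulLieIdeal hleib hB) := by
  obtain ⟨n, hn⟩ := hBs
  have key (k : ℕ) (x : leftMulLieIdeal hleib hB)
      (hx : x ∈ LieAlgebra.derivedSeries ℂ (leftMulLieIdeal hleib hB) k) :
      (x : Module.End ℂ M) ∈ (leibDerivedSeries br B k).map br := by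
    induction k generalizing x with
    | zero => exact x.2
    | succ k ih =>
      rw [LieAlgebra.derivedSeries_def, LieAlgebra.derivedSeriesOfIdeal_succ,
        ← LieSubmodule.mem_toSubmodule,
        LieSubmodule.lieIdeal_oper_eq_linear_span'] at hx
      induction hx using Submodule.span_induction with
      | mem x h =>
        obtain ⟨a, ha, b, hb, rfl⟩ := h
        obtain ⟨u, hu, hua⟩ := ih a ha
        obtain ⟨v, hv, hvb⟩ := ih b hb
        refine ⟨br u v, Submodule.subset_span ⟨u, hu, v, hv, rfl⟩, ?_⟩
        rw [← lie_leftMul hleib, hua, hvb]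
        rfl
      | zero => exact Submodule.zero_mem _
      | add x y _ _ hx hy => exact Submodule.add_mem _ hx hy
      | smul c x _ hx => exact Submodule.smul_mem _ c hx
  refine LieAlgebra.IsSolvable.mk (R := ℂ) (k := n) ((LieSubmodule.eq_bot_iff _).2 fun x hx => ?_)
  have h := key n x hx
  rw [hn, Submodule.map_bot, Submodule.mem_bot] at h
  exact Subtype.ext (Subtype.ext h)

/-- The subspace `[M, B]`. -/
def bracketSpan (br : M →ₗ[ℂ] M →ₗ[ℂ] M) (B : Submodule ℂ M) : Submodule ℂ M :=
  Submodule.span ℂ {y | ∃ m : M, ∃ b ∈ B, br m b = y}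

/-- The descending series `U`, `[P, U] + N`, `[P, [P, U]] + N`, ... -/
def descendingSeries (br : M →ₗ[ℂ] M →ₗ[ℂ] M) (P N U : Submodule ℂ M) : ℕ → Submodule ℂ M
  | 0 => U
  | i + 1 => Submodule.span ℂ {y | ∃ p ∈ P, ∃ u ∈ descendingSeries br P N U i, br p u = y} ⊔ N

lemma exists_descendingSeries_eq_bot [FiniteDimensional ℂ M] (hleib : IsLeftLeibniz br)
    {B : Submodule ℂ M} (hB : IsTwoSidedIdeal br B) (hBs : IsLeibnizSolvable br B) :
    ∃ n, descendingSeries br (bracketSpan br B) ⊥ ⊤ n = ⊥ := by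
  have := isSolvable_leftMulLieIdeal hleib hB hBs
  set I := leftMulLieIdeal hleib hB
  have := isNilpotent_lie_of_isSolvable (V := M) I
  set J : LieIdeal ℂ (leftMulLieSubalgebra hleib) :=
    ⁅(⊤ : LieIdeal ℂ (leftMulLieSubalgebra hleib)), I⁆ with hJ
  obtain ⟨n, hn⟩ := (LieModule.isNilpotent_iff ℂ J M).1 this
  have hP (p : M) (hp : p ∈ bracketSpan br B) :
      (⟨br p, p, rfl⟩ : leftMulLieSubalgebra hleib) ∈ J := by
    induction hp using Submodule.span_induction with
    | mem p h =>
      obtain ⟨m, b, hb, rfl⟩ := h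
      convert LieSubmodule.lie_mem_lie
        (LieSubmodule.mem_top (⟨br m, m, rfl⟩ : leftMulLieSubalgebra hleib))
        (show (⟨br b, b, rfl⟩ : leftMulLieSubalgebra hleib) ∈ I from ⟨b, hb, rfl⟩)
      exact Subtype.ext (lie_leftMul hleib m b).symm
    | zero => convert zero_mem J; exact Subtype.ext (map_zero br)
    | add x y _ _ hx hy => convert add_mem hx hy; exact Subtype.ext (map_add br x y)
    | smul c x _ hx => simp only [map_smul]; exact J.toSubmodule.smul_mem c hx
  have key (i : ℕ) : descendingSeries br (bracketSpan br B) ⊥ ⊤ i ≤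
      (LieModule.lowerCentralSeries ℂ J M i).toSubmodule := by
    induction i with
    | zero => simp
    | succ i ih =>
      rw [descendingSeries, sup_bot_eq, Submodule.span_le]
      rintro _ ⟨p, hp, u, hu, rfl⟩
      rw [LieModule.lowerCentralSeries_succ]
      exact LieSubmodule.lie_mem_lie (x := ⟨_, hP p hp⟩) (LieSubmodule.mem_top _) (ih hu)
  refine ⟨n, eq_bot_iff.2 ((key n).trans ?_)⟩
  rw [hn]
  rfl

/-- The Lie ring structure on a Lie subalgebra of a left Leibniz algebra. -/
abbrev lieRingOfIsLieSubalgebra (hleib : IsLeftLeibniz br) {T : Submodule ℂ M}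
    (hT : IsLieSubalgebra br T) : LieRing T where
  bracket x y := ⟨br x y, hT.1 x x.2 y y.2⟩
  add_lie x y z := Subtype.ext (by simp)
  lie_add x y z := Subtype.ext (by simp)
  lie_self x := Subtype.ext (hT.2 x x.2)
  leibniz_lie x y z := Subtype.ext (hleib x y z)

/-- The Lie algebra structure on a Lie subalgebra of a left Leibniz algebra. -/
abbrev lieAlgebraOfIsLieSubalgebra (hleib : IsLeftLeibniz br) {T : Submodule ℂ M}
    (hT : IsLieSubalgebra br T) :
    letI := lieRingOfIsLieSubalgebra hleib hT
    LieAlgebra ℂ T :=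
  letI := lieRingOfIsLieSubalgebra hleib hT
  { lie_smul := fun c x y => Subtype.ext (map_smul (br x) c (y : M)) }

/-- The action of a Lie subalgebra of a left Leibniz algebra on the whole algebra. -/
abbrev lieRingModuleOfIsLieSubalgebra (hleib : IsLeftLeibniz br) {T : Submodule ℂ M}
    (hT : IsLieSubalgebra br T) :
    letI := lieRingOfIsLieSubalgebra hleib hT
    LieRingModule T M :=
  letI := lieRingOfIsLieSubalgebra hleib hT
  { bracket := fun x m => br x m
    add_lie := fun x y m => by simp
    lie_add := fun x m n => map_add (br x) m n
    leibniz_lie := fun x y m => hleib x y m }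

lemma hasTrivialRadical_of_isSemisimpleSubalgebra [FiniteDimensional ℂ M]
    (hleib : IsLeftLeibniz br) {T : Submodule ℂ M} (hT : IsLieSubalgebra br T)
    (hTss : IsSemisimpleSubalgebra br T) :
    letI := lieRingOfIsLieSubalgebra hleib hT
    letI := lieAlgebraOfIsLieSubalgebra hleib hT
    LieAlgebra.HasTrivialRadical ℂ T := by
  let := lieRingOfIsLieSubalgebra hleib hT
  let := lieAlgebraOfIsLieSubalgebra hleib hT
  refine (LieAlgebra.hasTrivialRadical_iff_no_abelian_ideals ℂ T).2 fun I hI => ?_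
  have h := hTss (I.toSubmodule.map T.subtype) (Submodule.map_subtype_le _ _) ?_ ?_
  · simpa using Submodule.map_injective_of_injective T.injective_subtype
      (h.trans (Submodule.map_bot _).symm)
  · rintro s hs _ ⟨a, ha, rfl⟩
    exact ⟨⟨_, lie_mem_right ℂ T I ⟨s, hs⟩ a ha, rfl⟩, ⟨_, lie_mem_left ℂ T I a ⟨s, hs⟩ ha, rfl⟩⟩
  · rintro _ ⟨a, ha, rfl⟩ _ ⟨b, hb, rfl⟩
    exact congrArg (fun z : I => ((z : T) : M)) (hI.trivial ⟨a, ha⟩ ⟨b, hb⟩)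

lemma le_span_bracket_of_isSemisimpleSubalgebra [FiniteDimensional ℂ M]
    (hleib : IsLeftLeibniz br) {T : Submodule ℂ M} (hT : IsLieSubalgebra br T)
    (hTss : IsSemisimpleSubalgebra br T) :
    T ≤ Submodule.span ℂ {y | ∃ a ∈ T, ∃ b ∈ T, br a b = y} := by
  let := lieRingOfIsLieSubalgebra hleib hT
  let := lieAlgebraOfIsLieSubalgebra hleib hT
  have := hasTrivialRadical_of_isSemisimpleSubalgebra hleib hT hTss
  intro t ht
  have h : (⟨t, ht⟩ : T) ∈ ⁅(⊤ : LieIdeal ℂ T), (⊤ : LieIdeal ℂ T)⁆ := by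
    rw [lie_top_eq_top]; trivial
  rw [← LieSubmodule.mem_toSubmodule, LieSubmodule.lieIdeal_oper_eq_linear_span'] at h
  have h := Submodule.mem_map_of_mem (f := T.subtype) h
  rw [Submodule.map_span] at h
  refine Submodule.span_mono ?_ h
  rintro _ ⟨_, ⟨a, -, b, -, rfl⟩, rfl⟩
  exact ⟨a, a.2, b, b.2, rfl⟩

/-- The first Whitehead lemma for a semisimple Lie subalgebra of a left Leibniz algebra. -/
lemma exists_sub_bracket_mem_of_cocycle [FiniteDimensional ℂ M]
    (hleib : IsLeftLeibniz br) {T : Submodule ℂ M} (hT : IsLieSubalgebra br T)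
    (hTss : IsSemisimpleSubalgebra br T) {U W : Submodule ℂ M}
    (hU : ∀ m, ∀ u ∈ U, br m u ∈ U) (hW : ∀ m, ∀ w ∈ W, br m w ∈ W) (f : M →ₗ[ℂ] M)
    (hfU : ∀ t ∈ T, f t ∈ U)
    (hf : ∀ a ∈ T, ∀ b ∈ T, f (br a b) - (br a (f b) - br b (f a)) ∈ W) :
    ∃ v ∈ U, ∀ t ∈ T, f t - br t v ∈ W := by
  let := lieRingOfIsLieSubalgebra hleib hT
  let := lieAlgebraOfIsLieSubalgebra hleib hT
  let := lieRingModuleOfIsLieSubalgebra hleib hT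
  have : LieModule ℂ T M :=
    { smul_lie := fun c x m => LinearMap.map_smul₂ br c (x : M) m
      lie_smul := fun c x m => map_smul (br x) c m }
  have := hasTrivialRadical_of_isSemisimpleSubalgebra hleib hT hTss
  obtain ⟨v, hv, h⟩ := exists_sub_lie_mem_of_cocycle (L := T) (V := M)
    { U with lie_mem := fun {x m} hm => hU x m hm } { W with lie_mem := fun {x m} hm => hW x m hm }
    (f ∘ₗ T.subtype) (fun x => hfU x x.2) (fun x y => hf x x.2 y y.2)
  exact ⟨v, hv, fun t ht => h ⟨t, ht⟩⟩

lemma expSum_eq_exp [Module ℚ M] {D : Module.End ℂ M} {n : ℕ} (hD : D ^ n = 0) :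
    expSum D n = IsNilpotent.exp D := by
  rw [IsNilpotent.exp_eq_sum hD, expSum]
  refine Finset.sum_congr rfl fun i _ => LinearMap.ext fun m => ?_
  rw [LinearMap.smul_apply, LinearMap.smul_apply, ← Rat.cast_smul_eq_qsmul ℂ]
  simp

lemma bijective_expSum {D : Module.End ℂ M} {n : ℕ} (hD : D ^ n = 0) :
    Function.Bijective (expSum D n) := by
  let : Module ℚ M := Module.compHom M (algebraMap ℚ ℂ)
  rw [expSum_eq_exp hD]
  exact (Module.End.isUnit_iff _).1 (IsNilpotent.isUnit_exp ⟨n, hD⟩)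

lemma expSum_bracket {D : Module.End ℂ M} {n : ℕ} (hD : D ^ n = 0)
    (hder : ∀ a b, D (br a b) = br (D a) b + br a (D b)) (a b : M) :
    expSum D n (br a b) = br (expSum D n a) (expSum D n b) := by
  let : Module ℚ M := Module.compHom M (algebraMap ℚ ℂ)
  let : NonUnitalNonAssocRing M :=
    { (inferInstance : AddCommGroup M) with
      mul := fun a b => br a b
      left_distrib := fun a b c => map_add (br a) b c
      right_distrib := fun a b c => LinearMap.map_add₂ br a b c
      zero_mul := fun a => LinearMap.map_zero₂ br a
      mul_zero := fun a => map_zero (br a) }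
  have : SMulCommClass ℂ M M := ⟨fun c a b => (map_smul (br a) c b).symm⟩
  have : IsScalarTower ℂ M M := ⟨fun c a b => LinearMap.map_smul₂ br c a b⟩
  rw [expSum_eq_exp hD]
  exact Module.End.exp_mul_of_derivation ℂ M D (fun x y => (hder x y).trans (add_comm _ _))
    ⟨n, hD⟩ a b

lemma bracket_eq_zero_of_mem_leibnizKernel (hleib : IsLeftLeibniz br) {n : M}
    (hn : n ∈ leibnizKernel br) : br n = 0 := by
  induction hn using Submodule.span_induction with
  | mem x h =>
    obtain ⟨a, rfl⟩ := h
    exact LinearMap.ext fun c => by simpa using hleib a a c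
  | zero => exact map_zero br
  | add x y _ _ hx hy => rw [map_add, hx, hy, add_zero]
  | smul c x _ hx => rw [map_smul, hx, smul_zero]

lemma bracket_add_bracket_mem_leibnizKernel (br : M →ₗ[ℂ] M →ₗ[ℂ] M) (a b : M) :
    br a b + br b a ∈ leibnizKernel br := by
  have h (c : M) : br c c ∈ leibnizKernel br := Submodule.subset_span ⟨c, rfl⟩
  have := sub_mem (sub_mem (h (a + b)) (h a)) (h b)
  convert this using 1
  simp only [map_add, LinearMap.add_apply]
  abel

lemma bracket_mem_leibnizKernel (hleib : IsLeftLeibniz br) (m : M) {n : M}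
    (hn : n ∈ leibnizKernel br) : br m n ∈ leibnizKernel br := by
  have := bracket_add_bracket_mem_leibnizKernel br m n
  rwa [bracket_eq_zero_of_mem_leibnizKernel hleib hn, LinearMap.zero_apply, add_zero] at this

lemma leibnizKernel_le (hleib : IsLeftLeibniz br) {B : Submodule ℂ M}
    (hB : IsSolvableRadical br B) : leibnizKernel br ≤ B := by
  refine hB.2.2 _ (fun m u hu => ⟨bracket_mem_leibnizKernel hleib m hu, ?_⟩) ⟨1, ?_⟩
  · rw [bracket_eq_zero_of_mem_leibnizKernel hleib hu]
    exact zero_mem _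
  · refine (Submodule.span_eq_bot).2 ?_
    rintro _ ⟨a, ha, b, -, rfl⟩
    rw [bracket_eq_zero_of_mem_leibnizKernel hleib ha, LinearMap.zero_apply]

lemma le_descendingSeries {P N U : Submodule ℂ M} (hU : N ≤ U) (i : ℕ) :
    N ≤ descendingSeries br P N U i := by
  cases i with
  | zero => exact hU
  | succ i => exact le_sup_right

lemma bracket_mem_descendingSeries_succ {P N U : Submodule ℂ M} {i : ℕ} {p u : M} (hp : p ∈ P)
    (hu : u ∈ descendingSeries br P N U i) : br p u ∈ descendingSeries br P N U (i + 1) :=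
  Submodule.mem_sup_left (Submodule.subset_span ⟨p, hp, u, hu, rfl⟩)

lemma bracket_mem_descendingSeries (hleib : IsLeftLeibniz br) {P N U : Submodule ℂ M}
    (hP : ∀ m, ∀ p ∈ P, br m p ∈ P) (hN : ∀ m, ∀ n ∈ N, br m n ∈ N)
    (hU : ∀ m, ∀ u ∈ U, br m u ∈ U) (i : ℕ) (m : M) {u : M}
    (hu : u ∈ descendingSeries br P N U i) : br m u ∈ descendingSeries br P N U i := by
  induction i generalizing m u with
  | zero => exact hU m u hu
  | succ i ih =>
    obtain ⟨v, hv, n, hn, rfl⟩ := Submodule.mem_sup.1 hu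
    rw [map_add]
    refine add_mem ?_ (Submodule.mem_sup_right (hN m n hn))
    refine (Submodule.span_le.2 ?_ : _ ≤ (descendingSeries br P N U (i + 1)).comap (br m)) hv
    rintro _ ⟨p, hp, w, hw, rfl⟩
    rw [SetLike.mem_coe, Submodule.mem_comap, hleib]
    exact add_mem (bracket_mem_descendingSeries_succ (hP m p hp) hw)
      (bracket_mem_descendingSeries_succ hp (ih m hw))

lemma descendingSeries_antitone (hleib : IsLeftLeibniz br) {P N U : Submodule ℂ M}
    (hP : ∀ m, ∀ p ∈ P, br m p ∈ P) (hN : ∀ m, ∀ n ∈ N, br m n ∈ N)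
    (hU : ∀ m, ∀ u ∈ U, br m u ∈ U) (hNU : N ≤ U) : Antitone (descendingSeries br P N U) := by
  refine antitone_nat_of_succ_le fun i => sup_le (Submodule.span_le.2 ?_)
    (le_descendingSeries hNU i)
  rintro _ ⟨p, -, u, hu, rfl⟩
  exact bracket_mem_descendingSeries hleib hP hN hU i p hu

lemma descendingSeries_le_sup (P : Submodule ℂ M) {N : Submodule ℂ M} (U : Submodule ℂ M)
    (hN : ∀ m, ∀ n ∈ N, br m n ∈ N) (i : ℕ) :
    descendingSeries br P N U i ≤ descendingSeries br P ⊥ ⊤ i ⊔ N := by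
  induction i with
  | zero => exact le_top.trans le_sup_left
  | succ i ih =>
    refine sup_le (Submodule.span_le.2 ?_) le_sup_right
    rintro _ ⟨p, hp, u, hu, rfl⟩
    obtain ⟨v, hv, n, hn, rfl⟩ := Submodule.mem_sup.1 (ih hu)
    rw [map_add]
    exact add_mem (Submodule.mem_sup_left (bracket_mem_descendingSeries_succ hp hv))
      (Submodule.mem_sup_right (hN p n hn))

lemma pow_bracket_mem_descendingSeries {P : Submodule ℂ M} {p : M} (hp : p ∈ P) (m : M) (i : ℕ) :
    (br p ^ i) m ∈ descendingSeries br P ⊥ ⊤ i := by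
  induction i with
  | zero => trivial
  | succ i ih =>
    rw [pow_succ', Module.End.mul_apply]
    exact bracket_mem_descendingSeries_succ hp ih

lemma bracket_mem_bracketSpan {B : Submodule ℂ M}
    (hB : IsTwoSidedIdeal br B) (m : M) {p : M} (hp : p ∈ bracketSpan br B) :
    br m p ∈ bracketSpan br B := by
  refine Submodule.subset_span ⟨m, p, ?_, rfl⟩
  refine Submodule.span_le.2 ?_ hp
  rintro _ ⟨m, b, hb, rfl⟩
  exact (hB m b hb).1

/-- Modulo `K₁`, the exponential of `X + Y` differs from that of `X` by `Y` alone. -/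
lemma expSum_add_sub_mem {X Y : Module.End ℂ M} {K₀ K K₁ : Submodule ℂ M}
    (hX : ∀ m, X m ∈ K₀) (hXK : ∀ m ∈ K, X m ∈ K₁) (hXK₁ : ∀ m ∈ K₁, X m ∈ K₁)
    (hY : ∀ m, Y m ∈ K) (hYK : ∀ m ∈ K₀, Y m ∈ K₁) (hKK : K ≤ K₀) (n : ℕ) (m : M) :
    expSum (X + Y) (n + 2) m - (expSum X (n + 2) m + Y m) ∈ K₁ := by
  have hpow (j : ℕ) : ((X + Y) ^ (j + 2)) m - (X ^ (j + 2)) m ∈ K₁ := by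
    induction j with
    | zero =>
      have : ((X + Y) ^ (0 + 2)) m - (X ^ (0 + 2)) m = X (Y m) + Y (X m) + Y (Y m) := by
        simp only [zero_add, pow_two, Module.End.mul_apply, LinearMap.add_apply, map_add]
        abel
      rw [this]
      exact add_mem (add_mem (hXK _ (hY m)) (hYK _ (hX m))) (hYK _ (hKK (hY m)))
    | succ j ih =>
      have : ((X + Y) ^ (j + 1 + 2)) m - (X ^ (j + 1 + 2)) m =
          X (((X + Y) ^ (j + 2)) m - (X ^ (j + 2)) m) + Y (((X + Y) ^ (j + 2)) m) := by
        rw [show j + 1 + 2 = (j + 2) + 1 by ring, pow_succ' (X + Y), pow_succ' X,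
          Module.End.mul_apply, Module.End.mul_apply, LinearMap.add_apply, map_sub]
        abel
      rw [this]
      refine add_mem (hXK₁ _ ih) (hYK _ ?_)
      rw [pow_succ', Module.End.mul_apply]
      exact add_mem (hX _) (hKK (hY _))
  have : expSum (X + Y) (n + 2) m - (expSum X (n + 2) m + Y m) =
      ∑ j ∈ Finset.range n,
        (((j + 2).factorial : ℂ)⁻¹) • (((X + Y) ^ (j + 2)) m - (X ^ (j + 2)) m) := by
    simp only [expSum, Finset.sum_range_succ' _ (n + 1), Finset.sum_range_succ' _ n,
      LinearMap.add_apply, LinearMap.sum_apply, LinearMap.smul_apply, smul_sub,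
      Finset.sum_sub_distrib]
    simp
    abel
  rw [this]
  exact sum_mem fun j _ => Submodule.smul_mem _ _ (hpow j)

lemma expSum_sub_mem {X : Module.End ℂ M} {K : Submodule ℂ M} (hX : ∀ m, X m ∈ K) (n : ℕ) (m : M) :
    expSum X (n + 1) m - m ∈ K := by
  simp only [expSum, Finset.sum_range_succ', LinearMap.add_apply, LinearMap.sum_apply,
    LinearMap.smul_apply, pow_zero, Nat.factorial_zero, Nat.cast_one, inv_one, one_smul,
    Module.End.one_apply, add_sub_cancel_right]
  refine sum_mem fun j _ => Submodule.smul_mem _ _ ?_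
  rw [pow_succ', Module.End.mul_apply]
  exact hX _

/-- The filtration `K 0 = [M, B] + C(M)`, `K (i + 1) = [[M, B], K i] + C(M)`. -/
abbrev malcevSeries (br : M →ₗ[ℂ] M →ₗ[ℂ] M) (B : Submodule ℂ M) : ℕ → Submodule ℂ M :=
  descendingSeries br (bracketSpan br B) (leibnizKernel br) (bracketSpan br B ⊔ leibnizKernel br)

lemma bracket_mem_sup_leibnizKernel (hleib : IsLeftLeibniz br) {B : Submodule ℂ M}
    (hB : IsTwoSidedIdeal br B) (m : M) {u : M} (hu : u ∈ bracketSpan br B ⊔ leibnizKernel br) :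
    br m u ∈ bracketSpan br B ⊔ leibnizKernel br := by
  obtain ⟨p, hp, n, hn, rfl⟩ := Submodule.mem_sup.1 hu
  rw [map_add]
  exact Submodule.add_mem_sup (bracket_mem_bracketSpan hB m hp)
    (bracket_mem_leibnizKernel hleib m hn)

lemma leibnizKernel_le_malcevSeries (br : M →ₗ[ℂ] M →ₗ[ℂ] M) (B : Submodule ℂ M) (i : ℕ) :
    leibnizKernel br ≤ malcevSeries br B i :=
  le_descendingSeries le_sup_right i

lemma bracket_mem_malcevSeries (hleib : IsLeftLeibniz br) {B : Submodule ℂ M}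
    (hB : IsTwoSidedIdeal br B) (i : ℕ) (m : M) {u : M} (hu : u ∈ malcevSeries br B i) :
    br m u ∈ malcevSeries br B i :=
  bracket_mem_descendingSeries hleib (fun m _ => bracket_mem_bracketSpan hB m)
    (fun m _ => bracket_mem_leibnizKernel hleib m)
    (fun m _ => bracket_mem_sup_leibnizKernel hleib hB m) i m hu

lemma bracket_swap_mem {K : Submodule ℂ M} (hK : leibnizKernel br ≤ K) {a b : M}
    (h : br a b ∈ K) : br b a ∈ K :=
  (add_mem_cancel_left h).1 (hK (bracket_add_bracket_mem_leibnizKernel br a b))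

lemma malcevSeries_antitone (hleib : IsLeftLeibniz br) {B : Submodule ℂ M}
    (hB : IsTwoSidedIdeal br B) : Antitone (malcevSeries br B) :=
  descendingSeries_antitone hleib (fun m _ => bracket_mem_bracketSpan hB m)
    (fun m _ => bracket_mem_leibnizKernel hleib m)
    (fun m _ => bracket_mem_sup_leibnizKernel hleib hB m) le_sup_right

lemma bracket_mem_malcevSeries_succ (hleib : IsLeftLeibniz br) {B : Submodule ℂ M} {i : ℕ}
    {a u : M} (ha : a ∈ malcevSeries br B 0) (hu : u ∈ malcevSeries br B i) :
    br a u ∈ malcevSeries br B (i + 1) := by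
  obtain ⟨p, hp, n, hn, rfl⟩ := Submodule.mem_sup.1 ha
  rw [map_add, bracket_eq_zero_of_mem_leibnizKernel hleib hn, add_zero]
  exact bracket_mem_descendingSeries_succ hp hu

lemma malcevSeries_zero_le (hleib : IsLeftLeibniz br) {B : Submodule ℂ M}
    (hB : IsSolvableRadical br B) : malcevSeries br B 0 ≤ B := by
  refine sup_le (Submodule.span_le.2 ?_) (leibnizKernel_le hleib hB)
  rintro _ ⟨m, b, hb, rfl⟩
  exact (hB.1 m b hb).1

/-- If `e` is an automorphism congruent to the identity modulo `K 0` which maps `T` into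
`S + K i`, then the component of `e` along `B` is a cocycle on `T` modulo `K (i + 1)`. -/
lemma projection_cocycle_mem (hleib : IsLeftLeibniz br) {B S T : Submodule ℂ M}
    (hB : IsSolvableRadical br B) (hS : IsLieSubalgebra br S) (hBS : IsCompl B S)
    {e : Module.End ℂ M} (he : ∀ a b, e (br a b) = br (e a) (e b))
    (he0 : ∀ m, e m - m ∈ malcevSeries br B 0) {i : ℕ}
    (heT : ∀ t ∈ T, e t ∈ S ⊔ malcevSeries br B i) :
    (∀ t ∈ T, B.projection S hBS (e t) ∈ malcevSeries br B i) ∧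
    ∀ a ∈ T, ∀ b ∈ T, B.projection S hBS (e (br a b)) -
      (br a (B.projection S hBS (e b)) - br b (B.projection S hBS (e a))) ∈
        malcevSeries br B (i + 1) := by
  set π := B.projection S hBS
  have hπS {s : M} (hs : s ∈ S) : π s = 0 := (Submodule.projection_apply_eq_zero_iff hBS).2 hs
  have hπB {b : M} (hb : b ∈ B) : π b = b := Submodule.projection_apply_of_mem_left hBS hb
  have hKi : malcevSeries br B i ≤ malcevSeries br B 0 :=
    malcevSeries_antitone hleib hB.1 (Nat.zero_le i)
  have hK0 : malcevSeries br B 0 ≤ B := malcevSeries_zero_le hleib hB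
  have hdec (t : M) (ht : t ∈ T) : ∃ s ∈ S, ∃ u ∈ malcevSeries br B i, e t = s + u ∧
      π (e t) = u := by
    obtain ⟨s, hs, u, hu, h⟩ := Submodule.mem_sup.1 (heT t ht)
    exact ⟨s, hs, u, hu, h.symm, by rw [← h, map_add, hπS hs, zero_add, hπB (hK0 (hKi hu))]⟩
  refine ⟨fun t ht => ?_, fun a ha b hb => ?_⟩
  · obtain ⟨s, hs, u, hu, -, h⟩ := hdec t ht
    rwa [h]
  obtain ⟨s, hs, u, hu, hea, hπa⟩ := hdec a ha
  obtain ⟨r, hr, v, hv, heb, hπb⟩ := hdec b hb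
  have hsa : s - a ∈ malcevSeries br B 0 := by
    have := sub_mem (he0 a) (hKi hu)
    rwa [hea, show s + u - a - u = s - a by abel] at this
  have hrb : r - b ∈ malcevSeries br B 0 := by
    have := sub_mem (he0 b) (hKi hv)
    rwa [heb, show r + v - b - v = r - b by abel] at this
  have hN := leibnizKernel_le_malcevSeries br B (i + 1)
  have hsum : br (e a) (e b) = br s r + (br s v + br u r + br u v) := by
    rw [hea, heb]
    simp only [map_add, LinearMap.add_apply]
    abel
  rw [hπa, hπb, he, hsum, map_add, hπS (hS.1 s hs r hr), zero_add,
    hπB (add_mem (add_mem (hB.1 s v (hK0 (hKi hv))).1 (hB.1 r u (hK0 (hKi hu))).2)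
      (hB.1 u v (hK0 (hKi hv))).1)]
  have h := add_mem (add_mem (sub_mem (bracket_mem_malcevSeries_succ hleib hsa hv)
    (bracket_mem_malcevSeries_succ hleib hrb hu))
    (hN (bracket_add_bracket_mem_leibnizKernel br u r)))
    (bracket_mem_malcevSeries_succ hleib (hKi hu) hv)
  convert h using 1
  simp only [map_sub, LinearMap.sub_apply]
  abel

/-- The inductive step: an exponential moving `T` into `S + K i` can be corrected to move `T` into
`S + K (i + 1)`. -/
lemma exists_expSum_mem_sup_succ [FiniteDimensional ℂ M] (hleib : IsLeftLeibniz br)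
    {B S T : Submodule ℂ M}
    (hB : IsSolvableRadical br B) (hS : IsLieSubalgebra br S) (hBS : IsCompl B S)
    (hT : IsLieSubalgebra br T) (hTss : IsSemisimpleSubalgebra br T) {n i : ℕ}
    (hn : ∀ x ∈ bracketSpan br B, br x ^ (n + 2) = 0) {x : M} (hx : x ∈ bracketSpan br B)
    (hxT : ∀ t ∈ T, expSum (br x) (n + 2) t ∈ S ⊔ malcevSeries br B i) :
    ∃ y ∈ bracketSpan br B,
      ∀ t ∈ T, expSum (br y) (n + 2) t ∈ S ⊔ malcevSeries br B (i + 1) := by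
  set e := expSum (br x) (n + 2)
  have hN := leibnizKernel_le_malcevSeries br B
  have hx0 : x ∈ malcevSeries br B 0 := Submodule.mem_sup_left hx
  have hxm (m : M) : br x m ∈ malcevSeries br B 0 :=
    bracket_swap_mem (hN 0) (bracket_mem_malcevSeries hleib hB.1 0 m hx0)
  obtain ⟨hσ, hcoc⟩ := projection_cocycle_mem hleib hB hS hBS
    (expSum_bracket (hn x hx) (hleib x)) (expSum_sub_mem hxm (n + 1)) hxT
  obtain ⟨v, hv, hvT⟩ := exists_sub_bracket_mem_of_cocycle hleib hT hTss
    (fun m _ => bracket_mem_malcevSeries hleib hB.1 i m)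
    (fun m _ => bracket_mem_malcevSeries hleib hB.1 (i + 1) m)
    (B.projection S hBS ∘ₗ e) hσ hcoc
  obtain ⟨k, hk, c, hc, rfl⟩ :=
    Submodule.mem_sup.1 (malcevSeries_antitone hleib hB.1 (Nat.zero_le i) hv)
  have hki : k ∈ malcevSeries br B i := (add_mem_cancel_right (hN i hc)).1 hv
  refine ⟨x + k, add_mem hx hk, fun t ht => ?_⟩
  have hexp := expSum_add_sub_mem (X := br x) (Y := br k) (K₀ := malcevSeries br B 0)
    (K := malcevSeries br B i) (K₁ := malcevSeries br B (i + 1)) hxm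
    (fun m hm => bracket_mem_malcevSeries_succ hleib hx0 hm)
    (fun m hm => bracket_mem_malcevSeries hleib hB.1 (i + 1) x hm)
    (fun m => bracket_swap_mem (hN i) (bracket_mem_malcevSeries hleib hB.1 i m hki))
    (fun m hm => bracket_swap_mem (hN (i + 1)) (bracket_mem_malcevSeries_succ hleib hm hki))
    (malcevSeries_antitone hleib hB.1 (Nat.zero_le i)) n t
  have hproj : e t - B.projection S hBS (e t) ∈ S := Submodule.sub_projection_mem hBS (e t)
  have hK := add_mem (add_mem (add_mem hexp (hvT t ht))
    (hN (i + 1) (bracket_add_bracket_mem_leibnizKernel br k t)))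
    (hN (i + 1) (bracket_mem_leibnizKernel hleib t hc))
  convert Submodule.add_mem_sup hproj hK using 1
  simp only [map_add, LinearMap.comp_apply]
  abel

end

/-- (Theorem 3.3)  If `S` is a Levi subalgebra of a left Leibniz algebra
`M` with `[S, C(M)] = 0`, then every semisimple Lie subalgebra `T` of `M` is mapped into
`S` by an automorphism `α = exp(ad x)` with `x ∈ [M, B]`. -/
theorem malcev_into_levi (M : Type*) [AddCommGroup M] [Module ℂ M]
    [FiniteDimensional ℂ M] (br : M →ₗ[ℂ] M →ₗ[ℂ] M) (hleib : IsLeftLeibniz br)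
    (B : Submodule ℂ M) (hB : IsSolvableRadical br B)
    (S : Submodule ℂ M) (hSlie : IsLieSubalgebra br S)
    (hSss : IsSemisimpleSubalgebra br S) (hScompl : IsCompl B S)
    (hSN : ∀ s ∈ S, ∀ n ∈ leibnizKernel br, br s n = 0)
    (T : Submodule ℂ M) (hTlie : IsLieSubalgebra br T)
    (hTss : IsSemisimpleSubalgebra br T) :
    ∃ x ∈ Submodule.span ℂ {y | ∃ m : M, ∃ b ∈ B, br m b = y}, ∃ n : ℕ,
      (br x) ^ n = 0 ∧
      Function.Bijective (expSum (br x) n) ∧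
      (∀ a b : M, expSum (br x) n (br a b) = br (expSum (br x) n a) (expSum (br x) n b)) ∧
      ∀ t ∈ T, expSum (br x) n t ∈ S := by
  have hspan := le_span_bracket_of_isSemisimpleSubalgebra hleib hTlie hTss
  obtain ⟨n, hn⟩ := exists_descendingSeries_eq_bot hleib hB.1 hB.2.1
  have hpow (x : M) (hx : x ∈ bracketSpan br B) : br x ^ (n + 2) = 0 := by
    have : br x ^ n = 0 := LinearMap.ext fun m => by
      simpa [hn] using pow_bracket_mem_descendingSeries (br := br) hx m n
    rw [pow_add, this, zero_mul]
  have hind (i : ℕ) : ∃ x ∈ bracketSpan br B,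
      ∀ t ∈ T, expSum (br x) (n + 2) t ∈ S ⊔ malcevSeries br B i := by
    induction i with
    | zero =>
      refine ⟨0, zero_mem _, fun t ht => ?_⟩
      have he : expSum (br 0) (n + 2) = 1 := by
        simp [expSum, Finset.sum_range_succ']
      rw [he, Module.End.one_apply]
      refine Submodule.span_le.2 ?_ (hspan ht)
      rintro _ ⟨a, -, b, -, rfl⟩
      have hdec (m : M) : ∃ c ∈ B, ∃ s ∈ S, c + s = m :=
        Submodule.mem_sup.1 (hScompl.sup_eq_top ▸ Submodule.mem_top)
      obtain ⟨c, hc, s, hs, rfl⟩ := hdec a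
      obtain ⟨d, hd, r, hr, rfl⟩ := hdec b
      have hP (m : M) {b : M} (hb : b ∈ B) : br m b ∈ malcevSeries br B 0 :=
        Submodule.mem_sup_left (Submodule.subset_span ⟨m, b, hb, rfl⟩)
      rw [SetLike.mem_coe]
      convert Submodule.add_mem_sup (hSlie.1 s hs r hr) (add_mem (hP (c + s) hd)
        (bracket_swap_mem (leibnizKernel_le_malcevSeries br B 0) (hP r hc))) using 1
      simp only [map_add, LinearMap.add_apply]
      abel
    | succ i ih =>
      obtain ⟨x, hx, hxT⟩ := ih
      exact exists_expSum_mem_sup_succ hleib hB hSlie hScompl hTlie hTss hpow hx hxT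
  obtain ⟨x, hx, hxT⟩ := hind n
  have hK : malcevSeries br B n ≤ leibnizKernel br := by
    have := descendingSeries_le_sup (bracketSpan br B) (bracketSpan br B ⊔ leibnizKernel br)
      (fun m _ => bracket_mem_leibnizKernel hleib m) n
    rwa [hn, bot_sup_eq] at this
  have hauto := expSum_bracket (hpow x hx) (hleib x)
  refine ⟨x, hx, n + 2, hpow x hx, bijective_expSum (hpow x hx), hauto, fun t ht => ?_⟩
  refine (Submodule.span_le.2 ?_ : _ ≤ S.comap (expSum (br x) (n + 2))) (hspan ht)
  rintro _ ⟨a, ha, b, hb, rfl⟩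
  obtain ⟨s, hs, c, hc, hsc⟩ := Submodule.mem_sup.1 (sup_le_sup_left hK S (hxT a ha))
  obtain ⟨r, hr, d, hd, hrd⟩ := Submodule.mem_sup.1 (sup_le_sup_left hK S (hxT b hb))
  rw [SetLike.mem_coe, Submodule.mem_comap, hauto, ← hsc, ← hrd, map_add, map_add,
    bracket_eq_zero_of_mem_leibnizKernel hleib hc, add_zero, hSN s hs d hd, add_zero]
  exact hSlie.1 s hs r hr
end

section
/- Let M be a finite-dimensional complex left Leibniz algebra with Leibniz kernel N = C(M) and solvable radical B = B(M), and suppose [B,N] = 0 (i.e., [b,n] = 0 for all b ∈ B, n ∈ N). Then for any two Levi subalgebras S₁ and S₂ of M, there exists a derivation f of M such that exp(f) maps S₁ onto S₂. -/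
open Submodule

section LieAux

attribute [local instance] LieRing.ofAssociativeRing

theorem LieModule.exists_lieSubmodule_ne_bot_lie_top_le {k L V : Type*} [Field k]
    [IsAlgClosed k] [CharZero k]
    [LieRing L] [LieAlgebra k L] [AddCommGroup V] [Module k V] [LieRingModule L V] [LieModule k L V]
    [FiniteDimensional k V] [Nontrivial V] (R : LieIdeal k L) [LieAlgebra.IsSolvable R] :
    ∃ W : LieSubmodule k L V, W ≠ ⊥ ∧ ∀ x ∈ (⁅(⊤ : LieIdeal k L), R⁆ : LieIdeal k L),
      ∀ w ∈ W, ⁅x, w⁆ = 0 := by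
  obtain ⟨χ, hχ⟩ := LieModule.exists_nontrivial_weightSpace_of_isSolvable k R V
  let W : LieSubmodule k L V := LieModule.weightSpaceOfIsLieTower k V χ
  have hW : Nontrivial W := hχ
  have hmem : ∀ (r : R) (w : V), w ∈ W → ⁅(r : L), w⁆ = χ r • w := fun r w hw =>
    (LieModule.mem_weightSpace χ w).mp hw r
  have hR : ∀ r : R, LieModule.toEnd k L W (r : L) = χ r • 1 := by
    intro r
    ext w
    simpa using hmem r w w.2
  refine ⟨W, (LieSubmodule.nontrivial_iff_ne_bot k L V).mp hW, ?_⟩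
  intro x hx w hw
  have key : (⁅(⊤ : LieIdeal k L), R⁆ : LieIdeal k L).toSubmodule ≤
      LinearMap.ker (LieModule.toEnd k L W).toLinearMap := by
    rw [LieSubmodule.lieIdeal_oper_eq_linear_span', Submodule.span_le]
    rintro _ ⟨y, -, r, hr, rfl⟩
    have hmemR : ⁅y, r⁆ ∈ R := lie_mem_right k L R y r hr
    have h1 := hR ⟨⁅y, r⁆, hmemR⟩
    have h2 : LinearMap.trace k W (LieModule.toEnd k L W ⁅y, r⁆) = 0 := by
      rw [LieHom.map_lie, LinearMap.trace_lie]
    have h3 : χ ⟨⁅y, r⁆, hmemR⟩ = 0 := by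
      rw [h1] at h2
      have : (Module.finrank k W : k) ≠ 0 := by
        exact_mod_cast Module.finrank_pos.ne'
      simpa [this] using h2
    simpa [h3] using h1
  have := LinearMap.congr_fun (LinearMap.mem_ker.mp (key hx)) ⟨w, hw⟩
  simpa using congrArg Subtype.val this

theorem LieModule.isNilpotent_toEnd_of_mem_lie_top {k L : Type*} [Field k] [IsAlgClosed k] [CharZero k]
    [LieRing L] [LieAlgebra k L] (R : LieIdeal k L) [LieAlgebra.IsSolvable R] {x : L}
    (hx : x ∈ (⁅(⊤ : LieIdeal k L), R⁆ : LieIdeal k L))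
    (V : Type*) [AddCommGroup V] [Module k V] [LieRingModule L V] [LieModule k L V]
    [FiniteDimensional k V] : _root_.IsNilpotent (LieModule.toEnd k L V x) := by
  induction hn : Module.finrank k V using Nat.strong_induction_on generalizing V with
  | _ n ih =>
  subst hn
  rcases subsingleton_or_nontrivial V with hV | hV
  · exact ⟨1, by ext v; exact Subsingleton.elim _ _⟩
  obtain ⟨W, hW, hxW⟩ := exists_lieSubmodule_ne_bot_lie_top_le (V := V) R
  have hlt : Module.finrank k (V ⧸ W) < Module.finrank k V := by
    have h1 := W.toSubmodule.finrank_quotient_add_finrank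
    have : Nontrivial W := (LieSubmodule.nontrivial_iff_ne_bot k L V).mpr hW
    have h2 : 0 < Module.finrank k W.toSubmodule := Module.finrank_pos (R := k) (M := W)
    change Module.finrank k (V ⧸ W.toSubmodule) < _
    omega
  obtain ⟨m, hm⟩ := ih _ hlt (V ⧸ W) rfl
  refine ⟨m + 1, ?_⟩
  ext v
  have hv : ((toEnd k L V x) ^ m) v ∈ W := by
    rw [← LieSubmodule.Quotient.mk_eq_zero']
    have : ∀ j, LieSubmodule.Quotient.mk (N := W) (((toEnd k L V x) ^ j) v) =
        ((toEnd k L (V ⧸ W) x) ^ j) (LieSubmodule.Quotient.mk v) := by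
      intro j
      induction j with
      | zero => rfl
      | succ j ihj =>
        rw [pow_succ', pow_succ', Module.End.mul_apply, Module.End.mul_apply, ← ihj]
        rfl
    rw [this, hm]; rfl
  rw [pow_succ', Module.End.mul_apply]
  exact hxW x hx _ hv

theorem LieAlgebra.lie_top_eq_top_of_hasTrivialRadical (k L : Type*) [Field k] [CharZero k]
    [LieRing L] [LieAlgebra k L] [FiniteDimensional k L] [HasTrivialRadical k L] :
    (⁅(⊤ : LieIdeal k L), (⊤ : LieIdeal k L)⁆ : LieIdeal k L) = ⊤ := by
  set P : LieIdeal k L := ⁅(⊤ : LieIdeal k L), (⊤ : LieIdeal k L)⁆ with hP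
  obtain ⟨Q, hQ⟩ := exists_isCompl P
  have hQab : IsLieAbelian Q := by
    rw [LieSubmodule.lie_abelian_iff_lie_self_eq_bot, eq_bot_iff, ← hQ.inf_eq_bot]
    exact le_inf (LieSubmodule.mono_lie le_top le_top) (LieSubmodule.lie_le_left Q Q)
  have : Q = ⊥ := HasTrivialRadical.eq_bot_of_isSolvable Q
  simpa [this] using hQ.sup_eq_top

theorem LinearMap.BilinForm.sum_dualBasis_of_skew {k W V ι : Type*} [Field k] [AddCommGroup W]
    [Module k W] [AddCommGroup V] [Module k V] [Fintype ι] [DecidableEq ι]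
    (B : LinearMap.BilinForm k W) (hB : B.Nondegenerate) (hsymm : B.IsSymm)
    (e : Module.Basis ι k W) (A : Module.End k W) (hA : ∀ w w', B (A w) w' = -B w (A w'))
    (F : W →ₗ[k] W →ₗ[k] V) :
    ∑ i, (F (A (e i)) (B.dualBasis hB e i) + F (e i) (A (B.dualBasis hB e i))) = 0 := by
  have : FiniteDimensional k W := e.finiteDimensional_of_finite
  set e' := B.dualBasis hB e with he'
  have h1 : ∀ w, w = ∑ j, B (e' j) w • e j := by
    intro w
    conv_lhs => rw [← e.sum_repr w]
    refine Finset.sum_congr rfl fun j _ => ?_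
    congr 1
    rw [← LinearMap.BilinForm.dualBasis_dualBasis hB hsymm e,
      LinearMap.BilinForm.dualBasis_repr_apply, hsymm.eq]
  have h2 : ∀ w, w = ∑ j, B w (e j) • e' j := by
    intro w
    conv_lhs => rw [← e'.sum_repr w]
    simp [he', LinearMap.BilinForm.dualBasis_repr_apply]
  have h3 : ∀ i, F (A (e i)) (e' i) = ∑ j, B (e' j) (A (e i)) • F (e j) (e' i) := by
    intro i
    conv_lhs => rw [h1 (A (e i))]
    simp
  have h4 : ∀ i, F (e i) (A (e' i)) = ∑ j, B (A (e' i)) (e j) • F (e i) (e' j) := by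
    intro i
    conv_lhs => rw [h2 (A (e' i))]
    simp
  simp_rw [Finset.sum_add_distrib, h3, h4]
  rw [Finset.sum_comm, ← Finset.sum_add_distrib]
  refine Finset.sum_eq_zero fun i _ => ?_
  rw [← Finset.sum_add_distrib]
  refine Finset.sum_eq_zero fun j _ => ?_
  rw [hA, neg_smul, add_neg_cancel]

/-- A Casimir operator for the trace form of a module over a semisimple Lie algebra: it commutes
with the action, turns every `1`-cocycle into a coboundary, and vanishes only if the trace form
does. -/
theorem LieModule.exists_casimir_s6 (k S V : Type*) [Field k] [CharZero k] [LieRing S]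
    [LieAlgebra k S] [FiniteDimensional k S] [LieAlgebra.HasTrivialRadical k S]
    [AddCommGroup V] [Module k V] [LieRingModule S V] [LieModule k S V] [FiniteDimensional k V] :
    ∃ c : Module.End k V, (∀ (x : S) (v : V), c ⁅x, v⁆ = ⁅x, c v⁆) ∧
      (∀ D : S →ₗ[k] V, (∀ x y : S, D ⁅x, y⁆ = ⁅x, D y⁆ - ⁅y, D x⁆) →
        ∃ w : V, ∀ x : S, ⁅x, w⁆ = c (D x)) ∧
      (c = 0 → traceForm k S V = 0) := by
  let τ := traceForm k S V
  let I : LieIdeal k S :=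
    { LinearMap.ker τ with
      lie_mem := by
        intro x y hy
        have hy' : τ y = 0 := hy
        change τ ⁅x, y⁆ = 0
        ext z
        have h := LinearMap.congr_fun hy' ⁅x, z⁆
        have := traceForm_apply_lie_apply k S V y x z
        rw [← lie_skew, map_neg, LinearMap.neg_apply]
        change -(traceForm k S V ⁅y, x⁆ z) = 0
        rw [this]
        change -(τ y ⁅x, z⁆) = 0
        rw [h]; simp }
  have hI : ∀ y, y ∈ I ↔ τ y = 0 := fun y => Iff.rfl
  obtain ⟨J, hJ⟩ := exists_isCompl I
  let B : LinearMap.BilinForm k J := τ.restrict J.toSubmodule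
  have hBapp : ∀ a b : J, B a b = LinearMap.trace k V (toEnd k S V a * toEnd k S V b) :=
    fun a b => rfl
  have hsymm : B.IsSymm := ⟨fun a b => traceForm_comm k S V a b⟩
  have hB : B.Nondegenerate := by
    have hleft : ∀ a : J, (∀ b : J, B a b = 0) → a = 0 := by
      intro a ha
      have haI : (a : S) ∈ I := by
        rw [hI]
        ext z
        have hz : z ∈ I ⊔ J := hJ.sup_eq_top ▸ LieSubmodule.mem_top z
        obtain ⟨p, hp, q, hq, rfl⟩ := LieSubmodule.mem_sup I J z |>.mp hz
        have h1 : τ a p = 0 := by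
          rw [show τ a p = τ p a from traceForm_comm k S V a p, (hI p).mp hp]; rfl
        have h2 : τ a q = 0 := ha ⟨q, hq⟩
        rw [map_add, h1, h2]; simp
      have : (a : S) ∈ I ⊓ J := ⟨haI, a.2⟩
      rw [hJ.inf_eq_bot] at this
      exact Subtype.ext this
    exact ⟨hleft, fun b hb => hleft b fun a => by rw [hsymm.eq]; exact hb a⟩
  let e := Module.finBasis k J
  let e' := B.dualBasis hB e
  let A : S → Module.End k J := fun x => toEnd k S J x
  have hA : ∀ x a b, B (A x a) b = -B a (A x b) := by
    intro x a b
    change traceForm k S V ⁅x, (a : S)⁆ b = -traceForm k S V a ⁅x, (b : S)⁆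
    rw [← lie_skew, map_neg, LinearMap.neg_apply, traceForm_apply_lie_apply]
  let φ : J →ₗ[k] Module.End k V := (toEnd k S V).toLinearMap ∘ₗ J.toSubmodule.subtype
  let F : J →ₗ[k] J →ₗ[k] Module.End k V := (LinearMap.mul k (Module.End k V)).compl₁₂ φ φ
  let c : Module.End k V := ∑ i, F (e i) (e' i)
  have hc : ∀ v, c v = ∑ i, ⁅(e i : S), ⁅(e' i : S), v⁆⁆ := by
    intro v
    simp only [c, LinearMap.sum_apply]
    rfl
  refine ⟨c, ?_, ?_, ?_⟩
  · intro x v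
    have h := B.sum_dualBasis_of_skew hB hsymm e (A x) (hA x) F
    have h' := LinearMap.congr_fun h v
    simp only [LinearMap.sum_apply, LinearMap.add_apply, LinearMap.zero_apply] at h'
    rw [← sub_eq_zero, ← neg_sub, hc, hc, lie_sum, ← Finset.sum_sub_distrib, neg_eq_zero, ← h']
    refine Finset.sum_congr rfl fun i _ => ?_
    change _ = ⁅⁅x, (e i : S)⁆, ⁅(e' i : S), v⁆⁆ + ⁅(e i : S), ⁅⁅x, (e' i : S)⁆, v⁆⁆
    rw [leibniz_lie x (e i : S), leibniz_lie x (e' i : S) v, lie_add]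
    abel
  · intro D hD
    refine ⟨∑ i, ⁅(e i : S), D (e' i)⁆, fun x => ?_⟩
    let G : J →ₗ[k] J →ₗ[k] V :=
      ((toEnd k S V).toLinearMap ∘ₗ J.toSubmodule.subtype).compl₂ (D ∘ₗ J.toSubmodule.subtype)
    have h := B.sum_dualBasis_of_skew hB hsymm e (A x) (hA x) G
    rw [← sub_eq_zero, hc, lie_sum, ← Finset.sum_sub_distrib, ← h]
    refine Finset.sum_congr rfl fun i _ => ?_
    change _ = ⁅⁅x, (e i : S)⁆, D (e' i)⁆ + ⁅(e i : S), D ⁅x, (e' i : S)⁆⁆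
    rw [leibniz_lie x (e i : S), hD, lie_sub]
    abel
  · intro hc0
    have htr : LinearMap.trace k V c = (Module.finrank k J : k) := by
      simp only [c, map_sum]
      have : ∀ i, LinearMap.trace k V (F (e i) (e' i)) = 1 := by
        intro i
        have := LinearMap.BilinForm.apply_dualBasis_right hB hsymm e i i
        rw [if_pos rfl] at this
        exact this
      simp [this]
    rw [hc0, map_zero] at htr
    have hJ0 : Module.finrank k J = 0 := by exact_mod_cast htr.symm
    have hJbot : J = ⊥ := by
      rw [← LieSubmodule.toSubmodule_eq_bot]
      exact Submodule.finrank_eq_zero.mp hJ0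
    have hItop : I = ⊤ := by simpa [hJbot] using hJ.sup_eq_top
    exact LinearMap.ext fun x => (hI x).mp (hItop ▸ LieSubmodule.mem_top x)

theorem LieModule.maxTrivSubmodule_ne_bot_of_traceForm_eq_zero (k S V : Type*) [Field k]
    [CharZero k] [LieRing S] [LieAlgebra k S] [FiniteDimensional k S]
    [LieAlgebra.HasTrivialRadical k S] [AddCommGroup V] [Module k V] [LieRingModule S V]
    [LieModule k S V] [FiniteDimensional k V] [Nontrivial V] (h : traceForm k S V = 0) :
    maxTrivSubmodule k S V ≠ ⊥ := by
  have hnil := isNilpotent_derivedSeries_of_traceForm_eq_zero h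
  have htop : LieAlgebra.derivedSeries k S 1 = ⊤ :=
    LieAlgebra.lie_top_eq_top_of_hasTrivialRadical k S
  have : IsNilpotent S V := by
    rw [isNilpotent_iff_forall' (R := k)]
    intro x
    exact (isNilpotent_iff_forall' (R := k)).mp hnil ⟨x, htop ▸ LieSubmodule.mem_top x⟩
  have := nontrivial_max_triv_of_isNilpotent k S V
  exact (LieSubmodule.nontrivial_iff_ne_bot k S V).mp this

/-- **Whitehead's first lemma**. -/
theorem LieModule.exists_eq_lie_of_isCocycle {k S V : Type*} [Field k] [CharZero k] [LieRing S]
    [LieAlgebra k S] [FiniteDimensional k S] [LieAlgebra.HasTrivialRadical k S]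
    [AddCommGroup V] [Module k V] [LieRingModule S V] [LieModule k S V] [FiniteDimensional k V]
    (D : S →ₗ[k] V) (hD : ∀ x y : S, D ⁅x, y⁆ = ⁅x, D y⁆ - ⁅y, D x⁆) :
    ∃ v : V, ∀ x : S, D x = ⁅x, v⁆ := by
  induction hn : Module.finrank k V using Nat.strong_induction_on generalizing V with
  | _ n ih =>
  subst hn
  have step : ∀ W : LieSubmodule k S V, W ≠ ⊥ → W ≠ ⊤ → ∃ v : V, ∀ x : S, D x = ⁅x, v⁆ := by
    intro W hbot htop
    have hsum := W.toSubmodule.finrank_quotient_add_finrank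
    have h1 : Module.finrank k W < Module.finrank k V :=
      Submodule.finrank_lt (s := W.toSubmodule) (by simpa [lt_top_iff_ne_top] using htop)
    have h2 : Module.finrank k (V ⧸ W) < Module.finrank k V := by
      have : Nontrivial W := (LieSubmodule.nontrivial_iff_ne_bot k S V).mpr hbot
      have h2 : 0 < Module.finrank k W.toSubmodule := Module.finrank_pos (R := k) (M := W)
      change Module.finrank k (V ⧸ W.toSubmodule) < _
      omega
    obtain ⟨q, hq⟩ := ih _ h2 (V := V ⧸ W) (W.toSubmodule.mkQ ∘ₗ D) (by
      intro x y
      rw [LinearMap.comp_apply, hD, map_sub]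
      rfl) rfl
    obtain ⟨u, rfl⟩ := LieSubmodule.Quotient.surjective_mk' W q
    have hmem : ∀ x, D x - ⁅x, u⁆ ∈ W := fun x =>
      (Submodule.Quotient.eq W.toSubmodule).mp (hq x)
    let D' : S →ₗ[k] W :=
      (D - (toEnd k S V).toLinearMap.flip u).codRestrict W.toSubmodule hmem
    have hD' : ∀ x, (D' x : V) = D x - ⁅x, u⁆ := fun x => rfl
    obtain ⟨w, hw⟩ := ih _ h1 D' (by
      intro x y
      apply Subtype.ext
      rw [LieSubmodule.coe_sub, LieSubmodule.coe_bracket, LieSubmodule.coe_bracket, hD', hD', hD',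
        hD, lie_sub, lie_sub, lie_lie]
      abel) rfl
    refine ⟨u + w, fun x => ?_⟩
    have := hD' x
    rw [hw, LieSubmodule.coe_bracket] at this
    rw [lie_add, this]
    abel
  rcases subsingleton_or_nontrivial V with hV | hV
  · exact ⟨0, fun x => Subsingleton.elim _ _⟩
  obtain ⟨c, hcomm, hcob, hc0⟩ := exists_casimir_s6 k S V
  by_cases hc : c = 0
  · by_cases htriv : maxTrivSubmodule k S V = ⊤
    · have htriv' : ∀ (x : S) (v : V), ⁅x, v⁆ = 0 := fun x v =>
        (mem_maxTrivSubmodule k S V v).mp (htriv ▸ LieSubmodule.mem_top v) x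
      refine ⟨0, fun x => ?_⟩
      have hx : x ∈ (⁅(⊤ : LieIdeal k S), (⊤ : LieIdeal k S)⁆ : LieIdeal k S).toSubmodule := by
        rw [LieAlgebra.lie_top_eq_top_of_hasTrivialRadical]; trivial
      have hle : (⁅(⊤ : LieIdeal k S), (⊤ : LieIdeal k S)⁆ : LieIdeal k S).toSubmodule ≤
          LinearMap.ker D := by
        rw [LieSubmodule.lieIdeal_oper_eq_linear_span', Submodule.span_le]
        rintro _ ⟨y, -, z, -, rfl⟩
        simp [hD, htriv']
      simpa using hle hx
    · exact step _ (maxTrivSubmodule_ne_bot_of_traceForm_eq_zero k S V (hc0 hc)) htriv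
  · let W : LieSubmodule k S V :=
      { LinearMap.ker c with
        lie_mem := by
          intro x v hv
          have hv' : c v = 0 := hv
          change c ⁅x, v⁆ = 0
          rw [hcomm, hv', lie_zero] }
    by_cases hW : W = ⊥
    · have hinj : Function.Injective c := by
        rw [← LinearMap.ker_eq_bot]
        exact (LieSubmodule.toSubmodule_eq_bot (N := W)).mpr hW
      obtain ⟨w, hw⟩ := hcob D hD
      obtain ⟨v, rfl⟩ := LinearMap.injective_iff_surjective.mp hinj w
      exact ⟨v, fun x => hinj (by rw [hcomm, hw])⟩
    · refine step W hW fun htop => hc ?_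
      rw [← LinearMap.ker_eq_top]
      exact (LieSubmodule.toSubmodule_eq_top (N := W)).mpr htop

theorem LieAlgebra.forall_mem_of_forall_lie_mem {k S V : Type*} [Field k] [CharZero k] [LieRing S]
    [LieAlgebra k S] [FiniteDimensional k S] [LieAlgebra.HasTrivialRadical k S]
    [AddCommGroup V] [Module k V] (h : S →ₗ[k] V) (W : Submodule k V)
    (hW : ∀ x y : S, h ⁅x, y⁆ ∈ W) (x : S) : h x ∈ W := by
  have hx : x ∈ (⁅(⊤ : LieIdeal k S), (⊤ : LieIdeal k S)⁆ : LieIdeal k S).toSubmodule := by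
    rw [LieAlgebra.lie_top_eq_top_of_hasTrivialRadical]; trivial
  have hle : (⁅(⊤ : LieIdeal k S), (⊤ : LieIdeal k S)⁆ : LieIdeal k S).toSubmodule ≤
      W.comap h := by
    rw [LieSubmodule.lieIdeal_oper_eq_linear_span', Submodule.span_le]
    rintro _ ⟨y, -, z, -, rfl⟩
    exact hW y z
  exact hle hx

theorem LieHom.exists_sub_sub_lie_mem {k S L : Type*} [Field k] [CharZero k] [LieRing S]
    [LieAlgebra k S] [FiniteDimensional k S] [LieAlgebra.HasTrivialRadical k S]
    [LieRing L] [LieAlgebra k L] [FiniteDimensional k L] (φ ψ : S →ₗ⁅k⁆ L) (I J : LieIdeal k L)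
    (hIJ : ⁅I, I⁆ ≤ J) (hφψ : ∀ s, ψ s - φ s ∈ I) :
    ∃ y ∈ I, ∀ s, ψ s - φ s - ⁅y, φ s⁆ ∈ J := by
  let J' : LieSubmodule k L I := LieSubmodule.comap (LieSubmodule.incl I) J
  let _ : LieRingModule S (I ⧸ J') := LieRingModule.compLieHom _ φ
  have _ : LieModule k S (I ⧸ J') := LieModule.compLieHom _ φ
  have hmk : ∀ a b : I, (LieSubmodule.Quotient.mk a : I ⧸ J') = LieSubmodule.Quotient.mk b ↔
      (a : L) - b ∈ J := fun a b => Submodule.Quotient.eq J'.toSubmodule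
  let d : S →ₗ[k] I := ((ψ : S →ₗ[k] L) - φ).codRestrict I.toSubmodule hφψ
  have hd : ∀ s, (d s : L) = ψ s - φ s := fun s => rfl
  obtain ⟨v, hv⟩ := LieModule.exists_eq_lie_of_isCocycle (J'.toSubmodule.mkQ ∘ₗ d) (by
    intro s t
    change (LieSubmodule.Quotient.mk (d ⁅s, t⁆) : I ⧸ J') =
      LieSubmodule.Quotient.mk (⁅φ s, d t⁆ - ⁅φ t, d s⁆)
    rw [hmk]
    have : (d ⁅s, t⁆ : L) - ((⁅φ s, d t⁆ - ⁅φ t, d s⁆ : I) : L) = ⁅(d s : L), (d t : L)⁆ := by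
      rw [LieSubmodule.coe_sub, LieSubmodule.coe_bracket, LieSubmodule.coe_bracket, hd, hd, hd,
        LieHom.map_lie, LieHom.map_lie]
      simp only [lie_sub, sub_lie]
      rw [← lie_skew (φ t) (ψ s), ← lie_skew (φ t) (φ s)]
      abel
    rw [this]
    exact hIJ (LieSubmodule.lie_mem_lie (d s).2 (d t).2))
  obtain ⟨y, rfl⟩ := LieSubmodule.Quotient.surjective_mk' J' v
  refine ⟨-y, neg_mem y.2, fun s => ?_⟩
  have := (hmk (d s) ⁅φ s, y⁆).mp (hv s)
  rwa [LieSubmodule.coe_bracket, hd, ← lie_skew, ← neg_lie] at this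

theorem expSum_eq_of_le {M : Type*} [AddCommGroup M] [Module ℂ M] {f : Module.End ℂ M} {n m : ℕ}
    (hf : f ^ n = 0) (hnm : n ≤ m) : expSum f m = expSum f n := by
  refine (Finset.sum_subset (Finset.range_mono hnm) fun i _ hi => ?_).symm
  rw [pow_eq_zero_of_le (by simpa using hi) hf, smul_zero]

theorem expSum_apply_of_derivation {M : Type*} [AddCommGroup M] [Module ℂ M]
    (br : M →ₗ[ℂ] M →ₗ[ℂ] M) (f : Module.End ℂ M)
    (hder : ∀ a b, f (br a b) = br (f a) b + br a (f b)) {n : ℕ} (hf : f ^ n = 0) (a b : M) :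
    expSum f n (br a b) = br (expSum f n a) (expSum f n b) := by
  let _ : NonUnitalNonAssocRing M :=
    { mul := fun a b => br a b
      left_distrib := fun a b c => map_add (br a) b c
      right_distrib := fun a b c => by
        change br (a + b) c = br a c + br b c
        simp
      zero_mul := fun a => by
        change br 0 a = 0
        simp
      mul_zero := fun a => map_zero (br a) }
  let _ : Module ℚ M := Module.compHom M (algebraMap ℚ ℂ)
  have : SMulCommClass ℂ M M := ⟨fun c a b => (map_smul (br a) c b).symm⟩
  have : IsScalarTower ℂ M M := ⟨fun c a b => by
    change br (c • a) b = c • br a b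
    simp⟩
  have hexp : expSum f n = IsNilpotent.exp f := by
    rw [IsNilpotent.exp_eq_sum hf, expSum]
    refine Finset.sum_congr rfl fun i _ => ?_
    ext m
    change ((i.factorial : ℂ)⁻¹) • (f ^ i) m = algebraMap ℚ ℂ ((i.factorial : ℚ)⁻¹) • (f ^ i) m
    simp
  rw [hexp]
  exact Module.End.exp_mul_of_derivation ℂ M f
    (fun x y => (hder x y).trans (add_comm _ _)) ⟨n, hf⟩ a b

theorem expSum_ad_add_sub_mem {L : Type*} [LieRing L] [LieAlgebra ℂ L] (K I J : LieIdeal ℂ L)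
    (hIK : I ≤ K) (hKI : ⁅K, I⁆ ≤ J) {x y : L} (hx : x ∈ K) (hy : y ∈ I) {n : ℕ}
    (hn : 2 ≤ n) (l : L) :
    expSum (LieAlgebra.ad ℂ L (x + y)) n l - expSum (LieAlgebra.ad ℂ L x) n l - ⁅y, l⁆ ∈ J := by
  set a := LieAlgebra.ad ℂ L (x + y) with ha
  set b := LieAlgebra.ad ℂ L x with hb
  have hK : ∀ k, (a ^ (k + 1)) l ∈ K := fun k => by
    rw [pow_succ', Module.End.mul_apply]
    exact lie_mem_left ℂ L K _ _ (add_mem hx (hIK hy))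
  have hrec : ∀ k, (a ^ (k + 1)) l - (b ^ (k + 1)) l =
      ⁅x, (a ^ k) l - (b ^ k) l⁆ + ⁅y, (a ^ k) l⁆ := fun k => by
    rw [pow_succ', pow_succ', Module.End.mul_apply, Module.End.mul_apply, ha, hb,
      LieAlgebra.ad_apply, LieAlgebra.ad_apply, add_lie, lie_sub]
    abel
  have hI : ∀ k, (a ^ k) l - (b ^ k) l ∈ I := by
    intro k
    induction k with
    | zero => simp
    | succ k ih =>
      rw [hrec]
      exact add_mem (lie_mem_right ℂ L I _ _ ih) (lie_mem_left ℂ L I _ _ hy)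
  have hJ : ∀ k, (a ^ (k + 2)) l - (b ^ (k + 2)) l ∈ J := by
    intro k
    rw [hrec]
    refine add_mem (hKI (LieSubmodule.lie_mem_lie hx (hI _))) ?_
    rw [← lie_skew]
    exact neg_mem (hKI (LieSubmodule.lie_mem_lie (hK k) hy))
  have hsum : expSum a n l - expSum b n l - ⁅y, l⁆ = ∑ i ∈ Finset.range n,
      (((i.factorial : ℂ)⁻¹) • ((a ^ i) l - (b ^ i) l) - if i = 1 then ⁅y, l⁆ else 0) := by
    rw [Finset.sum_sub_distrib, Finset.sum_ite_eq', if_pos (Finset.mem_range.mpr (by omega))]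
    simp only [expSum, LinearMap.sum_apply, LinearMap.smul_apply, smul_sub, Finset.sum_sub_distrib]
  rw [hsum]
  refine sum_mem fun i _ => ?_
  match i with
  | 0 => simp
  | 1 => simp [ha, hb]
  | i + 2 => simpa using J.smul_mem _ (hJ i)

/-- **Malcev's theorem**: two homomorphisms from a semisimple Lie algebra that agree modulo a
solvable ideal `R` are conjugate by the exponential of `ad x` for some `x ∈ ⁅L, R⁆`. -/
theorem LieHom.exists_expSum_ad_apply_eq {S L : Type*} [LieRing S]
    [LieAlgebra ℂ S] [FiniteDimensional ℂ S] [LieAlgebra.HasTrivialRadical ℂ S]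
    [LieRing L] [LieAlgebra ℂ L] [FiniteDimensional ℂ L] (φ ψ : S →ₗ⁅ℂ⁆ L) (R : LieIdeal ℂ L)
    [LieAlgebra.IsSolvable R] (hφψ : ∀ s, ψ s - φ s ∈ R) :
    ∃ x ∈ (⁅(⊤ : LieIdeal ℂ L), R⁆ : LieIdeal ℂ L), ∃ n, LieAlgebra.ad ℂ L x ^ n = 0 ∧
      ∀ s, expSum (LieAlgebra.ad ℂ L x) n (φ s) = ψ s := by
  set K : LieIdeal ℂ L := ⁅(⊤ : LieIdeal ℂ L), R⁆ with hK
  have hKnil : LieModule.IsNilpotent K L := by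
    rw [LieModule.isNilpotent_iff_forall' (R := ℂ)]
    exact fun x => LieModule.isNilpotent_toEnd_of_mem_lie_top R x.2 L
  obtain ⟨m, hm⟩ := (LieModule.isNilpotent_iff ℂ K L).mp hKnil
  let Q : ℕ → LieIdeal ℂ L := fun i => K ⊓ K.lcs L i
  have hQ : Q m = ⊥ := by
    rw [eq_bot_iff]
    refine inf_le_right.trans ?_
    rw [← LieSubmodule.toSubmodule_le_toSubmodule, LieIdeal.coe_lcs_eq, hm]
    exact le_rfl
  let n := Module.finrank ℂ L + 2
  have hpow : ∀ x ∈ K, LieAlgebra.ad ℂ L x ^ n = 0 := by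
    intro x hx
    have := LieModule.isNilpotent_toEnd_of_mem_lie_top R hx L
    refine pow_eq_zero_of_le (Nat.le_add_right _ 2) ?_
    have h := LinearMap.aeval_self_charpoly (LieModule.toEnd ℂ L L x)
    rw [this.charpoly_eq_X_pow_finrank, map_pow, Polynomial.aeval_X] at h
    exact h
  suffices H : ∀ i, ∃ x ∈ K, ∀ s, ψ s - expSum (LieAlgebra.ad ℂ L x) n (φ s) ∈ Q i by
    obtain ⟨x, hx, h⟩ := H m
    refine ⟨x, hx, n, hpow x hx, fun s => ?_⟩
    have := h s
    rw [hQ, LieSubmodule.mem_bot, sub_eq_zero] at this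
    exact this.symm
  have hexpK : ∀ x ∈ K, ∀ l, expSum (LieAlgebra.ad ℂ L x) n l - l ∈ K := by
    intro x hx l
    rw [expSum, LinearMap.sum_apply, Finset.sum_range_succ', add_sub_assoc]
    refine add_mem (sum_mem fun i _ => ?_) (by simp)
    rw [LinearMap.smul_apply, pow_succ', Module.End.mul_apply]
    exact K.smul_mem _ (lie_mem_left ℂ L K _ _ hx)
  intro i
  induction i with
  | zero =>
    refine ⟨0, zero_mem _, fun s => ?_⟩
    have h0 : expSum (LieAlgebra.ad ℂ L 0) n = 1 := by
      rw [expSum_eq_of_le (n := 1) (by simp) (by omega)]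
      simp [expSum]
    have hQ0 : Q 0 = K := by simp [Q]
    rw [h0, hQ0]
    refine LieAlgebra.forall_mem_of_forall_lie_mem ((ψ : S →ₗ[ℂ] L) - (φ : S →ₗ[ℂ] L)) K.toSubmodule
      (fun s t => ?_) s
    change ψ ⁅s, t⁆ - φ ⁅s, t⁆ ∈ K
    have : ψ ⁅s, t⁆ - φ ⁅s, t⁆ = ⁅φ s, ψ t - φ t⁆ - ⁅ψ t, ψ s - φ s⁆ := by
      rw [LieHom.map_lie, LieHom.map_lie, lie_sub, lie_sub, ← lie_skew (ψ t) (ψ s),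
        ← lie_skew (ψ t) (φ s)]
      abel
    rw [this]
    exact sub_mem (LieSubmodule.lie_mem_lie (LieSubmodule.mem_top _) (hφψ t))
      (LieSubmodule.lie_mem_lie (LieSubmodule.mem_top _) (hφψ s))
  | succ i ih =>
    obtain ⟨x, hx, h⟩ := ih
    have hIK : Q i ≤ K := inf_le_left
    have hKI : ⁅K, Q i⁆ ≤ Q (i + 1) := by
      refine le_inf ((LieSubmodule.mono_lie_right K hIK).trans (LieSubmodule.lie_le_left K K)) ?_
      rw [LieIdeal.lcs_succ]
      exact LieSubmodule.mono_lie_right K inf_le_right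
    let φx : S →ₗ⁅ℂ⁆ L :=
      { expSum (LieAlgebra.ad ℂ L x) n ∘ₗ (φ : S →ₗ[ℂ] L) with
        map_lie' := by
          intro s t
          change expSum (LieAlgebra.ad ℂ L x) n (φ ⁅s, t⁆) = _
          rw [LieHom.map_lie]
          exact expSum_apply_of_derivation (LieAlgebra.ad ℂ L).toLinearMap _
            (fun a b => leibniz_lie x a b) (hpow x hx) _ _ }
    have hφx : ∀ s, φx s = expSum (LieAlgebra.ad ℂ L x) n (φ s) := fun s => rfl
    obtain ⟨y, hy, hyd⟩ := φx.exists_sub_sub_lie_mem ψ (Q i) (Q (i + 1))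
      ((LieSubmodule.mono_lie_left (Q i) hIK).trans hKI) h
    refine ⟨x + y, add_mem hx (hIK hy), fun s => ?_⟩
    have h1 := hyd s
    have h2 := expSum_ad_add_sub_mem K (Q i) (Q (i + 1)) hIK hKI hx hy
      (show 2 ≤ n by omega) (φ s)
    have h3 : ⁅y, φx s - φ s⁆ ∈ Q (i + 1) := by
      rw [← lie_skew]
      exact neg_mem (hKI (LieSubmodule.lie_mem_lie (hexpK x hx _) hy))
    have h4 := sub_mem (add_mem h1 h3) h2
    rw [hφx] at h4
    convert h4 using 1
    rw [lie_sub]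
    abel

theorem IsLeftLeibniz.apply_apply_eq_lie {M : Type*} [AddCommGroup M] [Module ℂ M]
    {br : M →ₗ[ℂ] M →ₗ[ℂ] M} (hleib : IsLeftLeibniz br) (a b : M) :
    br (br a b) = (⁅(br a : Module.End ℂ M), (br b : Module.End ℂ M)⁆ : Module.End ℂ M) := by
  ext c
  rw [LieRing.of_associative_ring_bracket, LinearMap.sub_apply, Module.End.mul_apply,
    Module.End.mul_apply, hleib a b c, add_sub_cancel_right]

/-- The Lie ring structure on a Lie subalgebra of a Leibniz algebra. -/
abbrev IsLieSubalgebra.lieRing {M : Type*} [AddCommGroup M] [Module ℂ M]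
    {br : M →ₗ[ℂ] M →ₗ[ℂ] M} (hleib : IsLeftLeibniz br) {S : Submodule ℂ M}
    (hS : IsLieSubalgebra br S) : LieRing S where
  bracket a b := ⟨br a b, hS.1 a a.2 b b.2⟩
  add_lie a b c := Subtype.ext (LinearMap.map_add₂ br (a : M) b c)
  lie_add a b c := Subtype.ext (map_add (br a) (b : M) c)
  lie_self a := Subtype.ext (hS.2 a a.2)
  leibniz_lie a b c := Subtype.ext (hleib a b c)

/-- The Lie algebra structure on a Lie subalgebra of a Leibniz algebra. -/
abbrev IsLieSubalgebra.lieAlgebra {M : Type*} [AddCommGroup M] [Module ℂ M]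
    {br : M →ₗ[ℂ] M →ₗ[ℂ] M} (hleib : IsLeftLeibniz br) {S : Submodule ℂ M}
    (hS : IsLieSubalgebra br S) : letI := hS.lieRing hleib; LieAlgebra ℂ S :=
  letI := hS.lieRing hleib
  { lie_smul := fun c a b => Subtype.ext (map_smul (br a) c (b : M)) }

theorem IsSemisimpleSubalgebra.hasTrivialRadical {M : Type*} [AddCommGroup M] [Module ℂ M]
    [FiniteDimensional ℂ M] {br : M →ₗ[ℂ] M →ₗ[ℂ] M} (hleib : IsLeftLeibniz br)
    {S : Submodule ℂ M} (hS : IsLieSubalgebra br S) (hss : IsSemisimpleSubalgebra br S) :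
    letI := hS.lieRing hleib
    letI := hS.lieAlgebra hleib
    LieAlgebra.HasTrivialRadical ℂ S := by
  let _ := hS.lieRing hleib
  let _ := hS.lieAlgebra hleib
  rw [LieAlgebra.hasTrivialRadical_iff_no_abelian_ideals]
  intro I hI
  have h := hss (I.toSubmodule.map S.subtype) (Submodule.map_subtype_le _ _) ?_ ?_
  · rw [← LieSubmodule.toSubmodule_eq_bot]
    exact Submodule.map_injective_of_injective S.injective_subtype (h.trans (Submodule.map_bot _).symm)
  · rintro s hs _ ⟨a, ha, rfl⟩
    exact ⟨⟨_, lie_mem_right ℂ S I ⟨s, hs⟩ a ha, rfl⟩, ⟨_, lie_mem_left ℂ S I a ⟨s, hs⟩ ha, rfl⟩⟩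
  · rintro _ ⟨a, ha, rfl⟩ _ ⟨b, hb, rfl⟩
    have := LieModule.IsTrivial.trivial (⟨a, ha⟩ : I) (⟨b, hb⟩ : I)
    exact congrArg (fun x : I => ((x : S) : M)) this

theorem exists_expSum_sub_mem_ker {S M : Type*} [AddCommGroup M] [Module ℂ M]
    [FiniteDimensional ℂ M] {br : M →ₗ[ℂ] M →ₗ[ℂ] M} (hleib : IsLeftLeibniz br)
    {B : Submodule ℂ M} (hB : IsTwoSidedIdeal br B) (hsol : IsLeibnizSolvable br B)
    [LieRing S] [LieAlgebra ℂ S] [FiniteDimensional ℂ S] [LieAlgebra.HasTrivialRadical ℂ S]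
    (φ ψ : S →ₗ[ℂ] M) (hφ : ∀ s t, φ ⁅s, t⁆ = br (φ s) (φ t))
    (hψ : ∀ s t, ψ ⁅s, t⁆ = br (ψ s) (ψ t)) (hφψ : ∀ s, ψ s - φ s ∈ B) :
    ∃ a ∈ B, ∃ n, br a ^ n = (0 : Module.End ℂ M) ∧
      ∀ s, br (ψ s - expSum (br a) n (φ s)) = 0 := by
  let L : LieSubalgebra ℂ (Module.End ℂ M) :=
    { LinearMap.range br with
      lie_mem' := by
        rintro _ _ ⟨a, rfl⟩ ⟨b, rfl⟩
        exact ⟨br a b, hleib.apply_apply_eq_lie a b⟩ }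
  let π : M →ₗ[ℂ] L := br.rangeRestrict
  have hπ : ∀ a b, π (br a b) = ⁅π a, π b⁆ := fun a b =>
    Subtype.ext (hleib.apply_apply_eq_lie a b)
  have hπ_surj : ∀ x : L, ∃ a, π a = x := by
    rintro ⟨_, a, rfl⟩
    exact ⟨a, rfl⟩
  have hπ_lie : ∀ a m, ⁅π a, m⁆ = br a m := fun a m => rfl
  let R : LieIdeal ℂ L :=
    { B.map π with
      lie_mem := by
        rintro x _ ⟨b, hb, rfl⟩
        obtain ⟨a, rfl⟩ := hπ_surj x
        exact ⟨br a b, (hB a b hb).1, hπ a b⟩ }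
  have hder : ∀ n, (LieAlgebra.derivedSeriesOfIdeal ℂ L n R).toSubmodule ≤
      (leibDerivedSeries br B n).map π := by
    intro n
    induction n with
    | zero => exact le_rfl
    | succ n ih =>
      rw [LieAlgebra.derivedSeriesOfIdeal_succ, LieSubmodule.lieIdeal_oper_eq_linear_span',
        Submodule.span_le]
      rintro _ ⟨x, hx, y, hy, rfl⟩
      obtain ⟨a, ha, rfl⟩ := ih hx
      obtain ⟨b, hb, rfl⟩ := ih hy
      exact ⟨br a b, Submodule.subset_span ⟨a, ha, b, hb, rfl⟩, hπ a b⟩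
  have hR : LieAlgebra.IsSolvable R := by
    obtain ⟨n, hn⟩ := hsol
    refine LieAlgebra.IsSolvable.mk (R := ℂ) (k := n) ?_
    rw [LieIdeal.derivedSeries_eq_bot_iff, ← LieSubmodule.toSubmodule_eq_bot, eq_bot_iff]
    simpa [hn] using hder n
  let φ' : S →ₗ⁅ℂ⁆ L :=
    { π ∘ₗ φ with map_lie' := fun {s t} => (congrArg π (hφ s t)).trans (hπ _ _) }
  let ψ' : S →ₗ⁅ℂ⁆ L :=
    { π ∘ₗ ψ with map_lie' := fun {s t} => (congrArg π (hψ s t)).trans (hπ _ _) }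
  obtain ⟨x, hx, n, hn, h⟩ := φ'.exists_expSum_ad_apply_eq ψ' R
    fun s => ⟨_, hφψ s, map_sub π _ _⟩
  obtain ⟨a, ha, rfl⟩ : x ∈ R := LieSubmodule.lie_le_right R ⊤ hx
  obtain ⟨m, hm⟩ := LieModule.isNilpotent_toEnd_of_mem_lie_top R hx M
  have hm' : br a ^ m = (0 : Module.End ℂ M) := hm
  refine ⟨a, ha, max n m, pow_eq_zero_of_le (le_max_right n m) hm', fun s => ?_⟩
  have hcomm : ∀ k l, π ((br a ^ k : Module.End ℂ M) l) = (LieAlgebra.ad ℂ L (π a) ^ k) (π l) := by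
    intro k l
    induction k with
    | zero => rfl
    | succ k ih =>
      rw [pow_succ', pow_succ', Module.End.mul_apply, Module.End.mul_apply, hπ, ih,
        LieAlgebra.ad_apply]
  have hexp : π (expSum (br a) (max n m) (φ s)) = π (ψ s) := by
    refine Eq.trans ?_ (h s)
    rw [← expSum_eq_of_le hn (le_max_left n m)]
    simp only [expSum, LinearMap.sum_apply, LinearMap.smul_apply, map_sum, map_smul, hcomm]
    rfl
  have := sub_eq_zero.mpr hexp.symm
  rw [← map_sub] at this
  exact congrArg Subtype.val this

theorem IsTwoSidedIdeal.exists_projection {M : Type*} [AddCommGroup M] [Module ℂ M]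
    {br : M →ₗ[ℂ] M →ₗ[ℂ] M} {B S : Submodule ℂ M} (hB : IsTwoSidedIdeal br B)
    (hS : IsLieSubalgebra br S) (hBS : IsCompl B S) :
    ∃ q : M →ₗ[ℂ] M, (∀ m, q m ∈ S) ∧ (∀ m, m - q m ∈ B) ∧ (∀ b ∈ B, q b = 0) ∧
      (∀ s ∈ S, q s = s) ∧ ∀ a b, q (br a b) = br (q a) (q b) := by
  let q : M →ₗ[ℂ] M := S.projection B hBS.symm
  have hqS : ∀ m, q m ∈ S := Submodule.projection_apply_mem hBS.symm
  have hqs : ∀ s ∈ S, q s = s := fun s hs => Submodule.projection_apply_of_mem_left hBS.symm hs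
  have hqb : ∀ b ∈ B, q b = 0 := fun b hb => Submodule.projection_apply_of_mem_right hBS.symm hb
  have hqm : ∀ m, m - q m ∈ B := fun m => by
    rw [← Submodule.projection_apply_eq_zero_iff hBS.symm]
    change q (m - q m) = 0
    rw [map_sub, hqs _ (hqS m), sub_self]
  refine ⟨q, hqS, hqm, hqb, hqs, fun a b => ?_⟩
  have hab : br a b = br (q a) (q b) + (br (a - q a) (q b) + br a (b - q b)) := by
    simp only [map_sub, LinearMap.sub_apply]
    abel
  rw [hab, map_add, hqs _ (hS.1 _ (hqS a) _ (hqS b)),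
    hqb _ (add_mem (hB _ _ (hqm a)).2 (hB _ _ (hqm b)).1), add_zero]

theorem add_mem_leibnizKernel {M : Type*} [AddCommGroup M] [Module ℂ M]
    (br : M →ₗ[ℂ] M →ₗ[ℂ] M) (a b : M) : br a b + br b a ∈ leibnizKernel br := by
  have h : br a b + br b a = br (a + b) (a + b) - br a a - br b b := by
    simp only [map_add, LinearMap.add_apply]
    abel
  rw [h]
  exact sub_mem (sub_mem (Submodule.subset_span ⟨_, rfl⟩) (Submodule.subset_span ⟨_, rfl⟩))
    (Submodule.subset_span ⟨_, rfl⟩)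

theorem IsSolvableRadical.ker_le {M : Type*} [AddCommGroup M] [Module ℂ M]
    {br : M →ₗ[ℂ] M →ₗ[ℂ] M} (hleib : IsLeftLeibniz br) {B : Submodule ℂ M}
    (hB : IsSolvableRadical br B) : LinearMap.ker br ≤ B := by
  refine hB.2.2 _ (fun m u hu => ?_) ⟨1, ?_⟩
  · rw [LinearMap.mem_ker] at hu
    refine ⟨?_, by simp [hu]⟩
    ext c
    have := hleib m u c
    rw [hu] at this
    simpa using this.symm
  · rw [leibDerivedSeries, Submodule.span_eq_bot]
    rintro _ ⟨a, ha, b, -, rfl⟩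
    rw [leibDerivedSeries, LinearMap.mem_ker] at ha
    rw [ha, LinearMap.zero_apply]

theorem expSum_add_of_mul_eq_zero {M : Type*} [AddCommGroup M] [Module ℂ M]
    {f g : Module.End ℂ M} (hfg : f * g = 0) (hgf : g * f = 0) (hg : g * g = 0) {n : ℕ}
    (hn : 2 ≤ n) (hf : f ^ n = 0) : (f + g) ^ n = 0 ∧ expSum (f + g) n = expSum f n + g := by
  have hpow : ∀ k, (f + g) ^ (k + 2) = f ^ (k + 2) := by
    intro k
    induction k with
    | zero => simp [pow_two, mul_add, add_mul, hfg, hgf, hg]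
    | succ k ih => rw [pow_succ, ih, mul_add, ← pow_succ, pow_succ f (k + 1), mul_assoc, hfg,
        mul_zero, add_zero]
  obtain ⟨k, rfl⟩ := Nat.exists_eq_add_of_le' hn
  refine ⟨(hpow k).trans hf, ?_⟩
  simp only [expSum, Finset.sum_range_succ' _ (k + 1), Finset.sum_range_succ' _ k, add_assoc,
    Nat.reduceAdd, hpow]
  simp only [Nat.factorial_zero, Nat.factorial_one, Nat.cast_one, inv_one, one_smul, pow_zero,
    pow_one]
  abel

end LieAux

/-- (Theorem 3.5)  If `[B, C(M)] = 0` then any two Levi subalgebras of `M`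
are conjugate by the exponential of a derivation of `M`. -/
theorem levi_conjugate_by_derivation (M : Type*) [AddCommGroup M] [Module ℂ M]
    [FiniteDimensional ℂ M] (br : M →ₗ[ℂ] M →ₗ[ℂ] M) (hleib : IsLeftLeibniz br)
    (B : Submodule ℂ M) (hB : IsSolvableRadical br B)
    (hBN : ∀ b ∈ B, ∀ n ∈ leibnizKernel br, br b n = 0)
    (S₁ S₂ : Submodule ℂ M)
    (hS₁lie : IsLieSubalgebra br S₁) (hS₁ss : IsSemisimpleSubalgebra br S₁)
    (hS₁compl : IsCompl B S₁)
    (hS₂lie : IsLieSubalgebra br S₂) (hS₂ss : IsSemisimpleSubalgebra br S₂)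
    (hS₂compl : IsCompl B S₂) :
    ∃ f : Module.End ℂ M, (∀ a b : M, f (br a b) = br (f a) b + br a (f b)) ∧
      ∃ n : ℕ, f ^ n = 0 ∧ Submodule.map (expSum f n) S₁ = S₂ := by
  obtain ⟨q₁, hq₁S, hq₁sub, hq₁B, hq₁id, hq₁br⟩ := hB.1.exists_projection hS₁lie hS₁compl
  obtain ⟨q₂, hq₂S, hq₂sub, hq₂B, hq₂id, hq₂br⟩ := hB.1.exists_projection hS₂lie hS₂compl
  let _ := hS₁lie.lieRing hleib
  let _ := hS₁lie.lieAlgebra hleib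
  have _ := hS₁ss.hasTrivialRadical hleib hS₁lie
  obtain ⟨a, ha, n₀, hn₀, hker⟩ := exists_expSum_sub_mem_ker hleib hB.1 hB.2.1 S₁.subtype
    (q₂ ∘ₗ S₁.subtype) (fun _ _ => rfl) (fun _ _ => hq₂br _ _)
    (fun s => by simpa using neg_mem (hq₂sub s))
  let n := n₀ + 2
  have hn : br a ^ n = (0 : Module.End ℂ M) := pow_eq_zero_of_le (Nat.le_add_right n₀ 2) hn₀
  set e := expSum (br a) n with he
  have he_br : ∀ x y, e (br x y) = br (e x) (e y) :=
    expSum_apply_of_derivation br (br a) (hleib a) hn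
  have he_sub : ∀ m, m - e m ∈ B := by
    intro m
    rw [he, expSum, LinearMap.sum_apply, Finset.sum_range_succ', ← neg_mem_iff, neg_sub,
      add_sub_assoc]
    refine add_mem (sum_mem fun i _ => ?_) (by simp)
    rw [LinearMap.smul_apply, pow_succ', Module.End.mul_apply]
    exact B.smul_mem _ (hB.1 _ _ ha).2
  let g : Module.End ℂ M := q₂ - e ∘ₗ q₁
  have hg : ∀ m, g m = q₂ m - e (q₁ m) := fun m => rfl
  have hg_ker : ∀ m, br (g m) = 0 := by
    intro m
    have h := hker ⟨q₁ m, hq₁S m⟩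
    rw [← expSum_eq_of_le hn₀ (Nat.le_add_right n₀ 2)] at h
    have hq : q₂ m = q₂ (q₁ m) := by
      rw [← sub_eq_zero, ← map_sub, hq₂B _ (hq₁sub m)]
    rw [hg, hq]
    exact h
  have hgB : ∀ b ∈ B, g b = 0 := fun b hb => by rw [hg, hq₁B b hb, hq₂B b hb, map_zero, sub_zero]
  have hg_mem : ∀ m, g m ∈ B := fun m => hB.ker_le hleib (hg_ker m)
  have hg_br : ∀ x y, g (br x y) = br (e (q₁ x)) (g y) := by
    intro x y
    have hx : br (q₂ x) = br (e (q₁ x)) := by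
      rw [← sub_eq_zero, ← map_sub]
      exact hg_ker x
    rw [hg, hg, hq₂br, hq₁br, he_br, map_sub, hx]
  have hgN : ∀ m, g m ∈ leibnizKernel br := by
    intro m
    have hm : g m = g (q₁ m) := by
      rw [← sub_eq_zero, ← map_sub, hgB _ (hq₁sub m)]
    rw [hm]
    refine LieAlgebra.forall_mem_of_forall_lie_mem (g ∘ₗ S₁.subtype) (leibnizKernel br)
      (fun s t => ?_) ⟨q₁ m, hq₁S m⟩
    change g (br s t) ∈ _
    rw [hg_br, ← add_zero (br _ _), ← LinearMap.zero_apply (σ₁₂ := RingHom.id ℂ) (e (q₁ (s : M))),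
      ← hg_ker t]
    exact add_mem_leibnizKernel br _ _
  have hag : ∀ m, br a (g m) = 0 := fun m => hBN a ha _ (hgN m)
  obtain ⟨hpow, hexp⟩ := expSum_add_of_mul_eq_zero (f := br a) (g := g) (LinearMap.ext hag)
    (LinearMap.ext fun m => hgB _ (hB.1 m _ ha).2) (LinearMap.ext fun m => hgB _ (hg_mem m))
    (show 2 ≤ n by omega) hn
  have hmap : ∀ s ∈ S₁, expSum (br a + g) n s = q₂ s := by
    intro s hs
    rw [hexp, LinearMap.add_apply, hg, hq₁id s hs, ← he, add_sub_cancel]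
  refine ⟨br a + g, fun x y => ?_, n, hpow, ?_⟩
  · have hxy : br x (g y) = br (e (q₁ x)) (g y) := by
      rw [← sub_eq_zero, ← LinearMap.sub_apply, ← map_sub]
      refine hBN _ ?_ _ (hgN y)
      rw [← sub_add_sub_cancel x (q₁ x)]
      exact add_mem (hq₁sub x) (he_sub _)
    simp only [LinearMap.add_apply, map_add, hg_ker, LinearMap.zero_apply]
    rw [hleib a x y, hg_br, hxy]
    abel
  · ext m
    constructor
    · rintro ⟨s, hs, rfl⟩
      rw [hmap s hs]
      exact hq₂S s
    · intro hm
      refine ⟨q₁ m, hq₁S m, ?_⟩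
      rw [hmap _ (hq₁S m), ← sub_eq_zero, ← hq₂id m hm, ← map_sub, hq₂id m hm, ← neg_sub, map_neg,
        hq₂B _ (hq₁sub m), neg_zero]
end

section
/- Let M be a finite-dimensional complex left central Leibniz algebra and set ψ(a,b) := [a,b] + [b,a]. Then ψ is associative: ψ([a,b],c) = ψ(a,[b,c]) for all a,b,c ∈ M. Consequently, the radical R = {x ∈ M : ψ(x,a) = 0 for all a ∈ M} is a two-sided ideal of M. -/
open Submodule

section LeibnizLemmas

variable {M : Type*} [AddCommGroup M] [Module ℂ M] {br : M →ₗ[ℂ] M →ₗ[ℂ] M}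

/-- In a left Leibniz algebra, symmetrized brackets act trivially from the left. -/
theorem IsLeftLeibniz.bracket_add_swap_apply (h : IsLeftLeibniz br) (a b c : M) :
    br (br a b) c + br (br b a) c = 0 := by
  have hab := h a b c
  rw [h b a c] at hab
  rw [← sub_eq_zero] at hab
  rw [← neg_eq_zero, ← hab]
  abel

/-- In a left central algebra, symmetrized brackets are annihilated by left multiplication. -/
theorem IsLeftCentral.apply_add_apply_swap (h : IsLeftCentral br) (a b c : M) :
    br a (br b c) + br a (br c b) = 0 := by
  simpa [h a b, h a c, add_comm] using h a (b + c)

end LeibnizLemmas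

/-- (Lemma 4.1)  For a left central Leibniz algebra, the pairing
`ψ(a,b) = [a,b] + [b,a]` is associative, and consequently its radical `R` is a two-sided
ideal. -/
theorem psi_associative_radical_ideal (M : Type*) [AddCommGroup M] [Module ℂ M]
    [FiniteDimensional ℂ M] (br : M →ₗ[ℂ] M →ₗ[ℂ] M) (hleib : IsLeftLeibniz br)
    (hcent : IsLeftCentral br)
    (R : Submodule ℂ M) (hR : ∀ x : M, x ∈ R ↔ ∀ a : M, br x a + br a x = 0) :
    (∀ a b c : M,
      br (br a b) c + br c (br a b) = br a (br b c) + br (br b c) a) ∧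
    IsTwoSidedIdeal br R := by
  have invariant : ∀ a b c : M,
      br (br a b) c + br c (br a b) + (br b (br a c) + br (br a c) b) = 0 := by
    intro a b c
    have h := hcent.apply_add_apply_swap a b c
    rw [hleib a b c, hleib a c b] at h
    rw [← h]
    abel
  have assoc : ∀ a b c : M,
      br (br a b) c + br c (br a b) = br a (br b c) + br (br b c) a := by
    intro a b c
    have hl := hleib.bracket_add_swap_apply a b c
    have hr := hcent.apply_add_apply_swap c a b
    have hi := invariant b a c
    linear_combination (norm := module) hl + hr - hi
  refine ⟨assoc, fun m u hu => ?_⟩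
  have hum : br u m ∈ R := by
    rw [hR]
    intro a
    rw [assoc u m a]
    exact (hR u).1 hu (br m a)
  refine ⟨?_, hum⟩
  rw [eq_neg_of_add_eq_zero_right ((hR u).1 hu m)]
  exact R.neg_mem hum
end

section
/- Let M be a finite-dimensional complex left central Leibniz algebra with radical R, and let L ⊆ M be a Leibniz subalgebra. Then the following are equivalent: (a) [a,a] = 0 for all a ∈ L (L is a Lie subalgebra); (b) ψ(a,b) = 0 for all a,b ∈ L (L is totally isotropic); (c) the subspace L + R is a Leibniz subalgebra with [a,a] = 0 for all a ∈ L + R (L + R is a Lie subalgebra). -/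
open Submodule

/-- The radical of the symmetrized bracket of a left Leibniz algebra is a two-sided ideal. -/
lemma IsLeftLeibniz.isTwoSidedIdeal_radical {M : Type*} [AddCommGroup M] [Module ℂ M]
    {br : M →ₗ[ℂ] M →ₗ[ℂ] M} (hleib : IsLeftLeibniz br)
    {R : Submodule ℂ M} (hR : ∀ x : M, x ∈ R ↔ ∀ a : M, br x a + br a x = 0) :
    IsTwoSidedIdeal br R := by
  intro m x hx
  have hx' := (hR x).1 hx
  have hmx : br m x ∈ R := by
    refine (hR _).2 fun a => ?_
    have h : br m (br x a + br a x) = 0 := by rw [hx' a, map_zero]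
    rw [map_add, hleib m x a, hleib m a x] at h
    calc br (br m x) a + br a (br m x)
        = (br (br m x) a + br x (br m a) + (br (br m a) x + br a (br m x)))
          - (br x (br m a) + br (br m a) x) := by abel
      _ = 0 := by rw [h, hx', sub_zero]
  refine ⟨hmx, ?_⟩
  rw [eq_neg_of_add_eq_zero_left (hx' m)]
  exact R.neg_mem hmx

/-- A vector `x` with `[x,x] + [x,x] = 0` has `[x,x] = 0`. -/
lemma bracket_self_eq_zero {M : Type*} [AddCommGroup M] [Module ℂ M]
    {br : M →ₗ[ℂ] M →ₗ[ℂ] M} {x : M} (hx : br x x + br x x = 0) : br x x = 0 := by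
  rw [← two_smul ℂ] at hx
  exact (smul_eq_zero.1 hx).resolve_left two_ne_zero

/-- (Lemma 4.2)  For a Leibniz subalgebra `L` of a left central Leibniz
algebra the following are equivalent: `L` is a Lie subalgebra; `L` is totally isotropic;
`L + R` is a Lie subalgebra. -/
theorem lie_iff_isotropic_iff_sup_radical (M : Type*) [AddCommGroup M] [Module ℂ M]
    [FiniteDimensional ℂ M] (br : M →ₗ[ℂ] M →ₗ[ℂ] M) (hleib : IsLeftLeibniz br)
    (hcent : IsLeftCentral br)
    (R : Submodule ℂ M) (hR : ∀ x : M, x ∈ R ↔ ∀ a : M, br x a + br a x = 0)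
    (L : Submodule ℂ M) (hL : ∀ a ∈ L, ∀ b ∈ L, br a b ∈ L) :
    ((∀ a ∈ L, br a a = 0) ↔ IsTotallyIsotropic br L) ∧
    ((∀ a ∈ L, br a a = 0) ↔
      ((∀ a ∈ L ⊔ R, ∀ b ∈ L ⊔ R, br a b ∈ L ⊔ R) ∧ ∀ a ∈ L ⊔ R, br a a = 0)) := by
  refine ⟨⟨fun h a ha b hb => ?_, fun h a ha => bracket_self_eq_zero (h a ha a ha)⟩,
    fun h => ⟨fun a ha b hb => ?_, fun a ha => ?_⟩, fun h a ha => h.2 a (mem_sup_left ha)⟩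
  · have hab := h (a + b) (L.add_mem ha hb)
    simpa [h a ha, h b hb, add_comm] using hab
  · have hI := hleib.isTwoSidedIdeal_radical hR
    obtain ⟨l, hl, r, hr, rfl⟩ := mem_sup.1 ha
    obtain ⟨l', hl', r', hr', rfl⟩ := mem_sup.1 hb
    have hsplit : br (l + r) (l' + r') = br l l' + (br r l' + br (l + r) r') := by
      simp only [map_add, LinearMap.add_apply]; abel
    rw [hsplit]
    exact add_mem_sup (hL l hl l' hl') (R.add_mem (hI l' r hr).2 (hI (l + r) r' hr').1)
  · obtain ⟨l, hl, r, hr, rfl⟩ := mem_sup.1 ha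
    have hr' := (hR r).1 hr
    calc br (l + r) (l + r) = br l l + (br r l + br l r) + br r r := by
          simp only [map_add, LinearMap.add_apply]; abel
      _ = 0 := by rw [h l hl, hr' l, bracket_self_eq_zero (hr' r)]; simp
end
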